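/- arXiv:2108.06263 — 2 statements merged into one kernel-verified Lean document; each statement's English description precedes it below -/
import Mathlib

section
/- There exists a nonzero homogeneous polynomial of degree 19 on ℂ⁴⊗ℂ⁴⊗ℂ⁴ (a polynomial in 64 variables, the coordinates with respect to the basis of simple tensors of standard basis vectors) that vanishes at every tensor of rank at most 6 in ℂ⁴⊗ℂ⁴⊗ℂ⁴, i.e., the ideal of σ₆(Seg(ℙ³×ℙ³×ℙ³)) is nonzero in degree 19. -/
open scoped BigOperators

noncomputable section

/-- A tensor `T ∈ ℂ^{ι₁} ⊗ ℂ^{ι₂} ⊗ ℂ^{ι₃}`, written in coordinates, has rank at most `r`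
if it is a sum of `r` simple tensors. -/
def rankLE {ι₁ ι₂ ι₃ : Type*} (T : ι₁ → ι₂ → ι₃ → ℂ) (r : ℕ) : Prop :=
  ∃ u : Fin r → ι₁ → ℂ, ∃ v : Fin r → ι₂ → ℂ, ∃ w : Fin r → ι₃ → ℂ,
    T = fun i j k => ∑ l, u l i * v l j * w l k

/-- The rank of a tensor. -/
def trank {ι₁ ι₂ ι₃ : Type*} (T : ι₁ → ι₂ → ι₃ → ℂ) : ℕ :=
  sInf {r | rankLE T r}

/-- The border rank of a tensor: the least `r` such that `T` is a limit of tensors of rank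
at most `r` (closure in the Euclidean = product topology). -/
def brank {ι₁ ι₂ ι₃ : Type*} [Fintype ι₁] [Fintype ι₂] [Fintype ι₃]
    (T : ι₁ → ι₂ → ι₃ → ℂ) : ℕ :=
  sInf {r | T ∈ closure {S : ι₁ → ι₂ → ι₃ → ℂ | rankLE S r}}

/-- The matrix multiplication tensor `M⟨a,b,c⟩ = Σ e_{ij} ⊗ e_{jk} ⊗ e_{ki}`. -/
def matMulTensor (a b c : ℕ) :
    (Fin a × Fin b) → (Fin b × Fin c) → (Fin c × Fin a) → ℂ :=
  fun x y z => if x.2 = y.1 ∧ y.2 = z.1 ∧ z.2 = x.1 then 1 else 0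

/-- Kronecker product of tensors. -/
def kron {ι₁ ι₂ ι₃ κ₁ κ₂ κ₃ : Type*} (T : ι₁ → ι₂ → ι₃ → ℂ) (T' : κ₁ → κ₂ → κ₃ → ℂ) :
    (ι₁ × κ₁) → (ι₂ × κ₂) → (ι₃ × κ₃) → ℂ :=
  fun i j k => T i.1 j.1 k.1 * T' i.2 j.2 k.2

/-- The little Coppersmith–Winograd tensor
`cw_q = Σ_{i=1}^q (e₀⊗eᵢ⊗eᵢ + eᵢ⊗e₀⊗eᵢ + eᵢ⊗eᵢ⊗e₀)`. -/
def cw (q : ℕ) : Fin (q + 1) → Fin (q + 1) → Fin (q + 1) → ℂ :=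
  fun i j k =>
    if (i.val = 0 ∧ j = k ∧ j.val ≠ 0) ∨ (j.val = 0 ∧ i = k ∧ i.val ≠ 0) ∨
       (k.val = 0 ∧ i = j ∧ i.val ≠ 0)
    then 1 else 0

/-- The big Coppersmith–Winograd tensor `CW_{m-2} ∈ ℂ^m ⊗ ℂ^m ⊗ ℂ^m` (for `m ≥ 3`). -/
def bigCW (m : ℕ) : Fin m → Fin m → Fin m → ℂ :=
  fun i j k =>
    if (i.val = 0 ∧ j.val = 0 ∧ k.val = m - 1) ∨
       (i.val = 0 ∧ j.val = m - 1 ∧ k.val = 0) ∨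
       (i.val = m - 1 ∧ j.val = 0 ∧ k.val = 0) ∨
       (i.val = 0 ∧ j = k ∧ 1 ≤ j.val ∧ j.val ≤ m - 2) ∨
       (j.val = 0 ∧ i = k ∧ 1 ≤ i.val ∧ i.val ≤ m - 2) ∨
       (k.val = 0 ∧ i = j ∧ 1 ≤ i.val ∧ i.val ≤ m - 2)
    then 1 else 0

/-- The skew Coppersmith–Winograd tensor `T_{skewcw,2} ∈ ℂ³⊗ℂ³⊗ℂ³`. -/
def skewCW2 : Fin 3 → Fin 3 → Fin 3 → ℂ :=
  fun i j k =>
    if (i = 0 ∧ j = 1 ∧ k = 1) ∨ (i = 0 ∧ j = 2 ∧ k = 2) ∨ (i = 1 ∧ j = 0 ∧ k = 1) ∨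
       (i = 2 ∧ j = 0 ∧ k = 2) ∨ (i = 1 ∧ j = 2 ∧ k = 0)
    then 1
    else if i = 2 ∧ j = 1 ∧ k = 0 then -1 else 0

/-- Action of a triple of linear maps (matrices) on a tensor. -/
def triApply {a b c a' b' c' : ℕ}
    (g₁ : Matrix (Fin a') (Fin a) ℂ) (g₂ : Matrix (Fin b') (Fin b) ℂ)
    (g₃ : Matrix (Fin c') (Fin c) ℂ) (T : Fin a → Fin b → Fin c → ℂ) :
    Fin a' → Fin b' → Fin c' → ℂ :=
  fun i j k => ∑ i', ∑ j', ∑ k', g₁ i i' * g₂ j j' * g₃ k k' * T i' j' k'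

/-- The unit (diagonal) tensor `I_r ∈ ℂ^r ⊗ ℂ^r ⊗ ℂ^r`. -/
def unitTensor (r : ℕ) : Fin r → Fin r → Fin r → ℂ :=
  fun i j k => if i = j ∧ j = k then 1 else 0

/-- The unit tensor `I_r = Σ_{ℓ=1}^r a_ℓ⊗b_ℓ⊗c_ℓ` embedded in `ℂ^a ⊗ ℂ^b ⊗ ℂ^c`
(for `r ≤ min{a,b,c}`). -/
def unitIn (a b c r : ℕ) : Fin a → Fin b → Fin c → ℂ :=
  fun i j k => if i.val = j.val ∧ j.val = k.val ∧ i.val < r then 1 else 0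

/-- The subrank `Q(T)`: largest `r` so that linear maps take `T` to the unit tensor `I_r`. -/
def subrank {a b c : ℕ} (T : Fin a → Fin b → Fin c → ℂ) : ℕ :=
  sSup {r | ∃ f : Matrix (Fin r) (Fin a) ℂ, ∃ g : Matrix (Fin r) (Fin b) ℂ,
    ∃ h : Matrix (Fin r) (Fin c) ℂ, triApply f g h T = unitTensor r}

/-- The `GL(A) × GL(B) × GL(C)`-orbit of a tensor. -/
def glOrbit {a b c : ℕ} (T : Fin a → Fin b → Fin c → ℂ) :
    Set (Fin a → Fin b → Fin c → ℂ) :=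
  {S | ∃ g₁ : Matrix (Fin a) (Fin a) ℂ, ∃ g₂ : Matrix (Fin b) (Fin b) ℂ,
    ∃ g₃ : Matrix (Fin c) (Fin c) ℂ, IsUnit g₁ ∧ IsUnit g₂ ∧ IsUnit g₃ ∧
      S = triApply g₁ g₂ g₃ T}

/-- The border subrank `Q̲(T)`: largest `r` (with `r ≤ min{a,b,c}`) such that `I_r` lies in
the closure of the `GL×GL×GL`-orbit of `T`. -/
def bsubrank {a b c : ℕ} (T : Fin a → Fin b → Fin c → ℂ) : ℕ :=
  sSup {r | r ≤ min a (min b c) ∧ unitIn a b c r ∈ closure (glOrbit T)}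

/-- Multilinear rank in the `A`-factor: rank of the contraction `T_A : A* → B⊗C`. -/
def mlA {a b c : ℕ} (T : Fin a → Fin b → Fin c → ℂ) : ℕ :=
  (Matrix.of fun (i : Fin a) (p : Fin b × Fin c) => T i p.1 p.2).rank

/-- Multilinear rank in the `B`-factor. -/
def mlB {a b c : ℕ} (T : Fin a → Fin b → Fin c → ℂ) : ℕ :=
  (Matrix.of fun (j : Fin b) (p : Fin a × Fin c) => T p.1 j p.2).rank

/-- Multilinear rank in the `C`-factor. -/
def mlC {a b c : ℕ} (T : Fin a → Fin b → Fin c → ℂ) : ℕ :=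
  (Matrix.of fun (k : Fin c) (p : Fin a × Fin b) => T p.1 p.2 k).rank

/-- `T` is `1_A`-generic: some contraction `T(α) : B* → C` has full rank `m`. -/
def oneAGeneric {m : ℕ} (T : Fin m → Fin m → Fin m → ℂ) : Prop :=
  ∃ α : Fin m → ℂ, (Matrix.of fun j k => ∑ i, α i * T i j k).rank = m

def oneBGeneric {m : ℕ} (T : Fin m → Fin m → Fin m → ℂ) : Prop :=
  ∃ β : Fin m → ℂ, (Matrix.of fun i k => ∑ j, β j * T i j k).rank = m

def oneCGeneric {m : ℕ} (T : Fin m → Fin m → Fin m → ℂ) : Prop :=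
  ∃ γ : Fin m → ℂ, (Matrix.of fun i j => ∑ k, γ k * T i j k).rank = m

/-- `T` is `1`-generic. -/
def oneGeneric {m : ℕ} (T : Fin m → Fin m → Fin m → ℂ) : Prop :=
  oneAGeneric T ∧ oneBGeneric T ∧ oneCGeneric T

/-- The symmetry Lie algebra `g̃_T ⊂ gl(A) ⊕ gl(B) ⊕ gl(C)` of a tensor, as a set. -/
def symLieSet {m : ℕ} (T : Fin m → Fin m → Fin m → ℂ) :
    Set (Matrix (Fin m) (Fin m) ℂ × Matrix (Fin m) (Fin m) ℂ × Matrix (Fin m) (Fin m) ℂ) :=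
  {XYZ | ∀ i j k, (∑ i', XYZ.1 i i' * T i' j k) + (∑ j', XYZ.2.1 j j' * T i j' k) +
    (∑ k', XYZ.2.2 k k' * T i j k') = 0}



/-! ### Invariants attached to designs -/

/-- Tensors in coordinates over a ring. -/
abbrev Ten (R : Type*) := Fin 4 → Fin 4 → Fin 4 → R

/-- Sign comparison of two indices. -/
def chi (x y : Fin 4) : ℤ := if x = y then 0 else if x < y then 1 else -1

/-- Sign of an index assignment `α` along the vertex map `a`. -/
def sg {m : ℕ} (a : ℕ → ℕ) (α : Fin m → Fin 4) : ℤ :=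
  ∏ e : Fin m, ∏ e' : Fin m, if e' < e ∧ a e' = a e then chi (α e') (α e) else 1

/-- A vertex map is regular if each of five vertices has exactly four edges. -/
def Reg (a : ℕ → ℕ) : Prop :=
  ∃ σ : Fin 5 × Fin 4 ≃ Fin 20, (∀ v s, a (σ (v, s)) = v) ∧ ∀ v, StrictMono (fun s => σ (v, s))

/-- The invariant of degree 20 given by a design. -/
def DD {R : Type*} [CommRing R] (a b c : ℕ → ℕ) (T : Ten R) : R :=
  ∑ α : Fin 20 → Fin 4, ∑ β : Fin 20 → Fin 4, ∑ γ : Fin 20 → Fin 4,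
    ((sg a α : ℤ) : R) * ((sg b β : ℤ) : R) * ((sg c γ : ℤ) : R) * ∏ e, T (α e) (β e) (γ e)

def actA {R : Type*} [CommRing R] (g : Matrix (Fin 4) (Fin 4) R) (T : Ten R) : Ten R :=
  fun i j k => ∑ i', g i i' * T i' j k
def actB {R : Type*} [CommRing R] (g : Matrix (Fin 4) (Fin 4) R) (T : Ten R) : Ten R :=
  fun i j k => ∑ j', g j j' * T i j' k
def actC {R : Type*} [CommRing R] (g : Matrix (Fin 4) (Fin 4) R) (T : Ten R) : Ten R :=
  fun i j k => ∑ k', g k k' * T i j k'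

/-- The sign of a quadruple. -/
def eps4 (x : Fin 4 → Fin 4) : ℤ :=
  ∏ s : Fin 4, ∏ s' : Fin 4, if s' < s then chi (x s') (x s) else 1

lemma eps4_perm : ∀ σ : Equiv.Perm (Fin 4), eps4 σ = Equiv.Perm.sign σ := by decide +kernel

lemma eps4_zero (x : Fin 4 → Fin 4) (h : ¬ Function.Injective x) : eps4 x = 0 := by
  revert x; decide +kernel

lemma eps4_sum {R : Type*} [CommRing R] (W : Fin 4 → Fin 4 → R) :
    ∑ x : Fin 4 → Fin 4, ((eps4 x : ℤ) : R) * ∏ s, W s (x s) = Matrix.det (Matrix.of W) := by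
  rw [← Matrix.det_transpose, Matrix.det_apply']
  symm
  apply Fintype.sum_of_injective (fun σ : Equiv.Perm (Fin 4) => (σ : Fin 4 → Fin 4))
  · exact DFunLike.coe_injective
  · intro x hx
    rw [eps4_zero]
    · simp
    · intro hi
      exact hx ⟨Equiv.ofBijective x (Finite.injective_iff_bijective.mp hi), rfl⟩
  · intro σ
    rw [eps4_perm]
    simp

lemma sg_eq (a : ℕ → ℕ) (σ : Fin 5 × Fin 4 ≃ Fin 20) (h1 : ∀ v s, a (σ (v, s)) = v)
    (h2 : ∀ v, StrictMono (fun s => σ (v, s))) (α : Fin 20 → Fin 4) :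
    sg a α = ∏ v : Fin 5, eps4 (fun s => α (σ (v, s))) := by
  unfold sg eps4
  rw [← σ.prod_comp, Fintype.prod_prod_type]
  refine Finset.prod_congr rfl fun v _ => Finset.prod_congr rfl fun s _ => ?_
  rw [← σ.prod_comp, Fintype.prod_prod_type, Finset.prod_eq_single v]
  · refine Finset.prod_congr rfl fun s' _ => ?_
    have : σ (v, s') < σ (v, s) ↔ s' < s := (h2 v).lt_iff_lt
    simp [this, h1]
  · intro w _ hw
    refine Finset.prod_eq_one fun s' _ => ?_
    rw [if_neg]
    rw [h1, h1]
    intro h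
    exact hw (Fin.ext h.2)
  · simp

lemma core_sum {R : Type*} [CommRing R] (a : ℕ → ℕ) (σ : Fin 5 × Fin 4 ≃ Fin 20)
    (h1 : ∀ v s, a (σ (v, s)) = v)
    (h2 : ∀ v, StrictMono (fun s => σ (v, s))) (W : Fin 20 → Fin 4 → R) :
    ∑ α : Fin 20 → Fin 4, ((sg a α : ℤ) : R) * ∏ e, W e (α e) =
      ∏ v : Fin 5, Matrix.det (Matrix.of fun s i => W (σ (v, s)) i) := by
  have : ∀ v : Fin 5, Matrix.det (Matrix.of fun s i => W (σ (v, s)) i) =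
      ∑ x : Fin 4 → Fin 4, ((eps4 x : ℤ) : R) * ∏ s, W (σ (v, s)) (x s) := fun v => (eps4_sum _).symm
  simp_rw [this]
  rw [Finset.prod_univ_sum, Fintype.piFinset_univ]
  let Φ : (Fin 20 → Fin 4) ≃ (Fin 5 → Fin 4 → Fin 4) :=
    (σ.symm.arrowCongr (Equiv.refl _)).trans (Equiv.curry _ _ _)
  rw [← Φ.sum_comp]
  refine Finset.sum_congr rfl fun α _ => ?_
  rw [Finset.prod_mul_distrib, sg_eq a σ h1 h2, ← σ.prod_comp, Fintype.prod_prod_type]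
  push_cast
  rfl

lemma core_act {R : Type*} [CommRing R] {a : ℕ → ℕ} (ha : Reg a) (g : Matrix (Fin 4) (Fin 4) R)
    (W : Fin 20 → Fin 4 → R) :
    ∑ α : Fin 20 → Fin 4, ((sg a α : ℤ) : R) * ∏ e, (∑ i, g (α e) i * W e i) =
     g.det ^ 5 * ∑ α : Fin 20 → Fin 4, ((sg a α : ℤ) : R) * ∏ e, W e (α e) := by
  obtain ⟨σ, h1, h2⟩ := ha
  rw [core_sum a σ h1 h2, core_sum a σ h1 h2 (fun e j => ∑ i, g j i * W e i)]
  have : ∀ v : Fin 5, (Matrix.of fun s j => ∑ i, g j i * W (σ (v, s)) i) =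
      (Matrix.of fun s i => W (σ (v, s)) i) * g.transpose := by
    intro v; ext s j; simp [Matrix.mul_apply, mul_comm]
  simp_rw [this, Matrix.det_mul, Matrix.det_transpose, Finset.prod_mul_distrib]
  simp [mul_comm]

lemma DD_A {R : Type*} [CommRing R] (a b c : ℕ → ℕ) (T : Ten R) : DD a b c T =
    ∑ β : Fin 20 → Fin 4, ∑ γ : Fin 20 → Fin 4, ((sg b β : ℤ) : R) * ((sg c γ : ℤ) : R) *
     ∑ α : Fin 20 → Fin 4, ((sg a α : ℤ) : R) * ∏ e, T (α e) (β e) (γ e) := by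
  unfold DD
  rw [Finset.sum_comm]
  refine Finset.sum_congr rfl fun β _ => ?_
  rw [Finset.sum_comm]
  refine Finset.sum_congr rfl fun γ _ => ?_
  rw [Finset.mul_sum]
  refine Finset.sum_congr rfl fun α _ => ?_
  ring

lemma DD_rot {R : Type*} [CommRing R] (a b c : ℕ → ℕ) (T : Ten R) :
    DD a b c T = DD b c a (fun j k i => T i j k) := by
  rw [DD_A]
  unfold DD
  refine Finset.sum_congr rfl fun β _ => ?_
  refine Finset.sum_congr rfl fun γ _ => ?_
  rw [Finset.mul_sum]
  refine Finset.sum_congr rfl fun α _ => ?_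
  ring

lemma DD_actA {R : Type*} [CommRing R] {a b c : ℕ → ℕ} (ha : Reg a)
    (g : Matrix (Fin 4) (Fin 4) R) (T : Ten R) :
    DD a b c (actA g T) = g.det ^ 5 * DD a b c T := by
  rw [DD_A, DD_A, Finset.mul_sum]
  refine Finset.sum_congr rfl fun β _ => ?_
  rw [Finset.mul_sum]
  refine Finset.sum_congr rfl fun γ _ => ?_
  unfold actA
  rw [core_act ha g (fun e i => T i (β e) (γ e))]
  ring

lemma DD_actB {R : Type*} [CommRing R] {a b c : ℕ → ℕ} (hb : Reg b)
    (g : Matrix (Fin 4) (Fin 4) R) (T : Ten R) :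
    DD a b c (actB g T) = g.det ^ 5 * DD a b c T := by
  rw [DD_rot, DD_rot a b c T]
  exact DD_actA hb g (fun j k i => T i j k)

lemma DD_actC {R : Type*} [CommRing R] {a b c : ℕ → ℕ} (hc : Reg c)
    (g : Matrix (Fin 4) (Fin 4) R) (T : Ten R) :
    DD a b c (actC g T) = g.det ^ 5 * DD a b c T := by
  rw [DD_rot, DD_rot, DD_rot a b c T, DD_rot b c a]
  exact DD_actA hc g (fun k i j => T i j k)

lemma map_DD {R S : Type*} [CommRing R] [CommRing S] (φ : R →+* S) (a b c : ℕ → ℕ) (T : Ten R) :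
    φ (DD a b c T) = DD a b c (fun i j k => φ (T i j k)) := by
  unfold DD
  simp [map_sum, map_mul, map_prod]

/-- Vertex maps read off from a list. -/
def vx (l : List ℕ) (e : ℕ) : ℕ := l.getD e 0

def reg_of_slots (l : List ℕ) (s : List (List ℕ)) : Prop :=
  Function.Injective (fun p : Fin 5 × Fin 4 => Fin.ofNat 20 ((s.getD p.1 []).getD p.2 0)) ∧
  (∀ p : Fin 5 × Fin 4, vx l (Fin.ofNat 20 ((s.getD p.1 []).getD p.2 0)) = p.1) ∧
  ∀ v : Fin 5, ∀ i j : Fin 4, i < j →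
    Fin.ofNat 20 ((s.getD v []).getD i 0) < Fin.ofNat 20 ((s.getD v []).getD j 0)

lemma Reg.of_slots {l : List ℕ} {s : List (List ℕ)} (h : reg_of_slots l s) : Reg (vx l) := by
  obtain ⟨h1, h2, h3⟩ := h
  refine ⟨Equiv.ofBijective _ ((Fintype.bijective_iff_injective_and_card _).mpr ⟨h1, by simp⟩),
    fun v s => h2 (v, s), fun v i j hij => h3 v i j hij⟩


/-! ### A list-based transfer algorithm, and its correctness -/

inductive SL | nil | cons (k p n : ℕ) (t : SL)
inductive ET | leaf (j k : Fin 4) (f w : ℕ) | node (l r : ET)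

structure Ent where
  i : Fin 4
  j : Fin 4
  k : Fin 4
  f : ℕ
  w : ℕ

/-- Parity tables: bit `x` of `tab i` is the parity of the bits of `x` above `i`. -/
def tab (i : ℕ) : ℕ :=
  Nat.rec 49980 (fun i _ => Nat.rec 4080 (fun i _ => Nat.rec 65280 (fun _ _ => 0) i) i) i

def SL.filt (m : ℕ) (L : SL) : SL :=
  SL.rec SL.nil (fun k p n _ ih =>
    Bool.rec ih (SL.cons k p n ih) (Nat.beq (Nat.land k m) 0)) L

def parOK (sA tA sB tB sC tC k : ℕ) : Bool :=
  Nat.beq (Nat.mod (Nat.add (Nat.shiftRight tA (Nat.mod (Nat.shiftRight k sA) 16))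
    (Nat.add (Nat.shiftRight tB (Nat.mod (Nat.shiftRight k sB) 16))
      (Nat.shiftRight tC (Nat.mod (Nat.shiftRight k sC) 16)))) 2) 0

def SL.put (m sA tA sB tB sC tC c : ℕ) (k p n : ℕ) (ih : SL) : SL :=
  Bool.rec (SL.cons (Nat.lor k m) (Nat.mul n c) (Nat.mul p c) ih)
    (SL.cons (Nat.lor k m) (Nat.mul p c) (Nat.mul n c) ih) (parOK sA tA sB tB sC tC k)

def SL.fm (m : ℕ) (F : ℕ → ℕ → ℕ → SL → SL) (L : SL) : SL :=
  SL.rec SL.nil (fun k p n _ ih =>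
    Bool.rec ih (F k p n ih) (Nat.beq (Nat.land k m) 0)) L

def SL.merge (L : SL) : SL → SL :=
  SL.rec (fun M => M) (fun k p n t ih M =>
    SL.rec (SL.cons k p n t) (fun k' p' n' t' ih' =>
      Bool.rec (Bool.rec (SL.cons k' p' n' ih') (SL.cons k (Nat.add p p') (Nat.add n n') (ih t'))
          (Nat.beq k k'))
        (SL.cons k p n (ih (SL.cons k' p' n' t'))) (Nat.blt k k')) M) L

def SL.rev (L : SL) : SL → SL :=
  SL.rec (fun M => M) (fun k p n _ ih M => ih (SL.cons k p n M)) L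

def SL.force (L : SL) (C : SL → SL) : SL :=
  SL.rec (C SL.nil) (fun k p n t _ => C (SL.cons k p n t)) L

def maskBC (b c j k f : ℕ) : ℕ :=
  Nat.lor (2 ^ (4 * (5 + b) + j)) (Nat.lor (2 ^ (4 * (10 + c) + k)) (f * 2 ^ 60))

def stepT (N a b c : ℕ) (i : Fin 4) (E : ET) (L : SL) : SL :=
  ET.rec (fun j k f w => SL.fm (maskBC b c j k f)
      (SL.put (Nat.lor (2 ^ (4 * a + i)) (maskBC b c j k f))
        (4 * a) (tab i) (4 * (5 + b)) (tab j) (4 * (10 + c)) (tab k) (2 ^ (N * w))) L)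
    (fun _ _ l r => SL.merge l r) E

def fstep (N a b c : ℕ) (i : Fin 4) (E : ET) (L : SL) : SL :=
  stepT N a b c i E (SL.filt (2 ^ (4 * a + i)) L)

def step4 (N a b c : ℕ) (E : Fin 4 → ET) (L : SL) : SL :=
  SL.merge (SL.merge (fstep N a b c 0 (E 0) L) (fstep N a b c 1 (E 1) L))
    (SL.merge (fstep N a b c 2 (E 2) L) (fstep N a b c 3 (E 3) L))

def run (N : ℕ) (E : Fin 4 → ET) (D : List (ℕ × ℕ × ℕ)) (L : SL) : SL :=
  List.rec (fun L => L) (fun e _ ih L =>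
    SL.force (SL.rev (step4 N e.1 e.2.1 e.2.2 E L) .nil)
      (fun L => SL.force (SL.rev L .nil) ih)) D L

/-- The linear functional represented by a list. -/
def SL.val (g : ℕ → ℤ) : SL → ℤ
  | .nil => 0
  | .cons k p n t => ((p : ℤ) - n) * g k + t.val g

lemma val_filt (m : ℕ) (g : ℕ → ℤ) (L : SL) :
    (L.filt m).val g = L.val (fun k => if k &&& m = 0 then g k else 0) := by
  induction L with
  | nil => rfl
  | cons k p n t ih =>
    have h : (SL.cons k p n t).filt m =
      Bool.rec (t.filt m) (SL.cons k p n (t.filt m)) (Nat.beq (k &&& m) 0) := rfl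
    rw [h]
    by_cases hk : k &&& m = 0
    · simp [hk, SL.val, ih]
    · have : Nat.beq (k &&& m) 0 = false := by
        rw [Bool.eq_false_iff]; intro h; exact hk (Nat.eq_of_beq_eq_true h)
      simp only [this, SL.val, ih, hk, if_false]; ring

lemma val_fm (m M sA tA sB tB sC tC c : ℕ) (g : ℕ → ℤ) (L : SL) :
    (L.fm m (SL.put M sA tA sB tB sC tC c)).val g =
      L.val (fun k => if k &&& m = 0 then
        (if parOK sA tA sB tB sC tC k then 1 else -1) * (c : ℤ) * g (k ||| M) else 0) := by
  induction L with
  | nil => rfl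
  | cons k p n t ih =>
    have h : (SL.cons k p n t).fm m (SL.put M sA tA sB tB sC tC c) =
      Bool.rec (t.fm m (SL.put M sA tA sB tB sC tC c))
        (Bool.rec (SL.cons (k ||| M) (n * c) (p * c) (t.fm m (SL.put M sA tA sB tB sC tC c)))
          (SL.cons (k ||| M) (p * c) (n * c) (t.fm m (SL.put M sA tA sB tB sC tC c)))
          (parOK sA tA sB tB sC tC k)) (Nat.beq (k &&& m) 0) := rfl
    rw [h]
    by_cases hk : k &&& m = 0
    · simp only [hk, SL.val, if_true]
      cases hp : parOK sA tA sB tB sC tC k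
      · simp only [SL.val, ih]; push_cast; simp; ring
      · simp only [SL.val, ih]; push_cast; simp; ring
    · have : Nat.beq (k &&& m) 0 = false := by
        rw [Bool.eq_false_iff]; intro h; exact hk (Nat.eq_of_beq_eq_true h)
      simp only [this, SL.val, ih, hk, if_false]; ring

lemma val_merge (g : ℕ → ℤ) (L : SL) : ∀ M : SL, (L.merge M).val g = L.val g + M.val g := by
  induction L with
  | nil => intro M; simp [SL.merge, SL.val]
  | cons k p n t ih =>
    intro M
    induction M with
    | nil => simp [SL.merge, SL.val]
    | cons k' p' n' t' ih' =>
      have h : (SL.cons k p n t).merge (SL.cons k' p' n' t') =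
        Bool.rec (Bool.rec (SL.cons k' p' n' ((SL.cons k p n t).merge t'))
          (SL.cons k (p + p') (n + n') (t.merge t')) (Nat.beq k k'))
          (SL.cons k p n (t.merge (SL.cons k' p' n' t'))) (Nat.blt k k') := rfl
      rw [h]
      cases Nat.blt k k'
      · cases hb : Nat.beq k k'
        · simp only [SL.val, ih'] ; ring
        · have := Nat.eq_of_beq_eq_true hb
          subst this
          simp only [SL.val, ih]; push_cast; ring
      · simp only [SL.val, ih]; ring

lemma val_rev (g : ℕ → ℤ) (L : SL) : ∀ M : SL, (L.rev M).val g = L.val g + M.val g := by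
  induction L with
  | nil => intro M; simp [SL.rev, SL.val]
  | cons k p n t ih =>
    intro M
    have : (SL.cons k p n t).rev M = t.rev (SL.cons k p n M) := rfl
    rw [this, ih]; simp only [SL.val]; ring

lemma force_eq (L : SL) (C : SL → SL) : L.force C = C L := by cases L <;> rfl

lemma val_add (L : SL) (g h : ℕ → ℤ) : L.val (fun k => g k + h k) = L.val g + L.val h := by
  induction L with
  | nil => rfl
  | cons k p n t ih => simp only [SL.val, ih]; ring

def ET.toL (i : Fin 4) : ET → List Ent
  | .leaf j k f w => [⟨i, j, k, f, w⟩]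
  | .node l r => l.toL i ++ r.toL i

def entL (E : Fin 4 → ET) : List Ent :=
  ((E 0).toL 0 ++ (E 1).toL 1) ++ ((E 2).toL 2 ++ (E 3).toL 3)

def mask (e : ℕ × ℕ × ℕ) (x : Ent) : ℕ := 2 ^ (4 * e.1 + x.i) ||| maskBC e.2.1 e.2.2 x.j x.k x.f

def trs (e : ℕ × ℕ × ℕ) (x : Ent) (k : ℕ) : ℤ :=
  if k &&& mask e x = 0 then
    (if parOK (4 * e.1) (tab x.i) (4 * (5 + e.2.1)) (tab x.j) (4 * (10 + e.2.2)) (tab x.k) k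
      then 1 else -1) else 0

def tr (N : ℕ) (e : ℕ × ℕ × ℕ) (x : Ent) (k : ℕ) : ℤ := trs e x k * 2 ^ (N * x.w)

lemma val_fstep (N : ℕ) (e : ℕ × ℕ × ℕ) (i : Fin 4) (E : ET) (g : ℕ → ℤ) (L : SL) :
    (fstep N e.1 e.2.1 e.2.2 i E L).val g = L.val (fun k =>
      ((E.toL i).map (fun x => tr N e x k * g (k ||| mask e x))).sum) := by
  unfold fstep
  induction E with
  | leaf j k f w =>
    have h : stepT N e.1 e.2.1 e.2.2 i (.leaf j k f w) (SL.filt (2 ^ (4 * e.1 + i)) L) =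
     SL.fm (maskBC e.2.1 e.2.2 j k f)
      (SL.put (2 ^ (4 * e.1 + i) ||| (maskBC e.2.1 e.2.2 j k f))
        (4 * e.1) (tab i) (4 * (5 + e.2.1)) (tab j) (4 * (10 + e.2.2)) (tab k) (2 ^ (N * w)))
        (SL.filt (2 ^ (4 * e.1 + i)) L) := rfl
    rw [h, val_fm, val_filt]
    congr 1
    funext x
    simp only [ET.toL, List.map_cons, List.map_nil, List.sum_cons, List.sum_nil, add_zero, tr, trs,
      mask, Nat.and_or_distrib_left, Nat.or_eq_zero_iff]
    by_cases h1 : x &&& 2 ^ (4 * e.1 + (i : ℕ)) = 0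
    · by_cases h2 : x &&& maskBC e.2.1 e.2.2 j k f = 0
      · simp [h1, h2]
      · simp [h2]
    · simp [h1]
  | node l r h1 h2 =>
    have h : stepT N e.1 e.2.1 e.2.2 i (.node l r) (SL.filt (2 ^ (4 * e.1 + i)) L) =
      SL.merge (stepT N e.1 e.2.1 e.2.2 i l (SL.filt (2 ^ (4 * e.1 + i)) L))
        (stepT N e.1 e.2.1 e.2.2 i r (SL.filt (2 ^ (4 * e.1 + i)) L)) := rfl
    rw [h, val_merge, h1, h2, ← val_add]
    simp only [ET.toL, List.map_append, List.sum_append]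

lemma val_step4 (N : ℕ) (e : ℕ × ℕ × ℕ) (E : Fin 4 → ET) (g : ℕ → ℤ) (L : SL) :
    (step4 N e.1 e.2.1 e.2.2 E L).val g = L.val (fun k =>
      ((entL E).map (fun x => tr N e x k * g (k ||| mask e x))).sum) := by
  unfold step4 entL
  simp only [val_merge, val_fstep, ← val_add, List.map_append, List.sum_append]

lemma run_append (N : ℕ) (E : Fin 4 → ET) (D : List (ℕ × ℕ × ℕ)) (e : ℕ × ℕ × ℕ) (g : ℕ → ℤ) :
    ∀ L : SL, (run N E (D ++ [e]) L).val g = (run N E D L).val (fun k =>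
      ((entL E).map (fun x => tr N e x k * g (k ||| mask e x))).sum) := by
  have hr : ∀ (e : ℕ × ℕ × ℕ) (D : List (ℕ × ℕ × ℕ)) (L : SL), run N E (e :: D) L =
      run N E D (((step4 N e.1 e.2.1 e.2.2 E L).rev .nil).rev .nil) := by
    intro e D L
    have : run N E (e :: D) L = SL.force (SL.rev (step4 N e.1 e.2.1 e.2.2 E L) .nil)
      (fun L => SL.force (SL.rev L .nil) (run N E D)) := rfl
    rw [this, force_eq, force_eq]
  induction D with
  | nil =>
    intro L
    rw [List.nil_append, hr]
    change SL.val g (((step4 N e.1 e.2.1 e.2.2 E L).rev .nil).rev .nil) = SL.val _ L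
    rw [val_rev, val_rev, val_step4]
    simp [SL.val]
  | cons d D ih =>
    intro L
    rw [List.cons_append, hr, hr, ih]

/-- Key reached after a sequence of entries. -/
def key (Ev : ℕ → ℕ × ℕ × ℕ) : (m : ℕ) → (Fin m → Ent) → ℕ
  | 0, _ => 0
  | m + 1, f => key Ev m (fun e => f e.castSucc) ||| mask (Ev m) (f (Fin.last m))

/-- Sign of a sequence of entries. -/
def Wt (Ev : ℕ → ℕ × ℕ × ℕ) : (m : ℕ) → (Fin m → Ent) → ℤ
  | 0, _ => 1
  | m + 1, f => Wt Ev m (fun e => f e.castSucc) *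
      trs (Ev m) (f (Fin.last m)) (key Ev m (fun e => f e.castSucc))

lemma val_congr_sum {ι : Type*} [Fintype ι] (h : ι → ℤ) (c : ι → ℕ) (g : ℕ → ℤ) (L : SL)
    (H : ∀ g, L.val g = ∑ l, h l * g (c l)) : L.val g = ∑ l, h l * g (c l) := H g

lemma run_val (N : ℕ) (E : Fin 4 → ET) (Ev : ℕ → ℕ × ℕ × ℕ) (m : ℕ) : ∀ (g : ℕ → ℤ),
    (run N E ((List.range m).map Ev) (.cons 0 1 0 .nil)).val g =
      ∑ l : Fin m → Fin (entL E).length, Wt Ev m (fun e => (entL E).get (l e)) *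
        2 ^ (N * ∑ e, ((entL E).get (l e)).w) * g (key Ev m (fun e => (entL E).get (l e))) := by
  induction m with
  | zero =>
    intro g
    simp [run, SL.val, Wt, key]
  | succ m ih =>
    intro g
    rw [List.range_succ, List.map_append, List.map_singleton, run_append, ih]
    rw [← (Fin.snocEquiv (fun _ => Fin (entL E).length)).sum_comp, Fintype.sum_prod_type,
      Finset.sum_comm]
    refine Finset.sum_congr rfl fun l _ => ?_
    have : ∀ F : Ent → ℤ, ((entL E).map F).sum = ∑ x : Fin (entL E).length, F ((entL E).get x) := by
      intro F
      rw [← List.sum_ofFn]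
      congr 1
      apply List.ext_get <;> simp
    rw [this, Finset.mul_sum]
    refine Finset.sum_congr rfl fun x _ => ?_
    simp only [Fin.snocEquiv, Equiv.coe_fn_mk, Wt, key, Fin.snoc_last, Fin.snoc_castSucc, tr,
      Fin.sum_univ_castSucc, mul_add, pow_add]
    ring


def nib (u k : ℕ) : ℕ := (k >>> (4 * u)) % 16

def tau (x : ℕ) (i : Fin 4) : ℤ :=
  if x.testBit i then 0 else if (tab i >>> x) % 2 = 0 then 1 else -1

lemma tau_or : ∀ x : Fin 16, ∀ i j : Fin 4, x.val.testBit j = false →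
    tau (x.val ||| 2 ^ j.val) i = tau x.val i * chi j i := by decide +kernel

lemma nib_lt (u k : ℕ) : nib u k < 16 := Nat.mod_lt _ (by norm_num)

lemma nib_or (u k l : ℕ) : nib u (k ||| l) = nib u k ||| nib u l := by
  unfold nib
  rw [Nat.shiftRight_or_distrib]
  exact Nat.or_mod_two_pow (n := 4)

lemma nib_pow : ∀ u v : Fin 15, ∀ i : Fin 4,
    nib u (2 ^ (4 * v.val + i.val)) = if v.val = u.val then 2 ^ i.val else 0 := by
  unfold nib; decide +kernel

lemma nib_testBit (u k : ℕ) (i : Fin 4) : (nib u k).testBit i = k.testBit (4 * u + i) := by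
  unfold nib
  rw [show (16 : ℕ) = 2 ^ 4 from rfl, Nat.testBit_mod_two_pow, Nat.testBit_shiftRight]
  simp

def okF (f : ℕ) : Prop := f = 0 ∨ f = 1 ∨ f = 2 ∨ f = 4

lemma nib_flag {f : ℕ} (hf : okF f) : ∀ u : Fin 15, nib u (f * 2 ^ 60) = 0 := by
  unfold nib
  rcases hf with rfl | rfl | rfl | rfl <;> decide +kernel

lemma pow_flag {f : ℕ} (hf : okF f) : ∀ v : Fin 15, ∀ i : Fin 4,
    2 ^ (4 * v.val + i.val) &&& (f * 2 ^ 60) = 0 := by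
  rcases hf with rfl | rfl | rfl | rfl <;> decide +kernel

lemma flag_flag {f f' : ℕ} (hf : okF f) (hf' : okF f') :
    ((f' * 2 ^ 60) &&& (f * 2 ^ 60) = 0) ↔ f' &&& f = 0 := by
  rcases hf with rfl | rfl | rfl | rfl <;> rcases hf' with rfl | rfl | rfl | rfl <;> decide +kernel

lemma and_pow_zero (k n : ℕ) : k &&& 2 ^ n = 0 ↔ k.testBit n = false := by
  rw [Nat.and_two_pow]
  cases k.testBit n <;> simp

lemma mask_eq (e : ℕ × ℕ × ℕ) (x : Ent) : mask e x = 2 ^ (4 * e.1 + x.i) |||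
    (2 ^ (4 * (5 + e.2.1) + x.j) ||| (2 ^ (4 * (10 + e.2.2) + x.k) ||| (x.f * 2 ^ 60))) := rfl

lemma trs_eq (e : ℕ × ℕ × ℕ) (x : Ent) (k : ℕ) : trs e x k =
    tau (nib e.1 k) x.i * tau (nib (5 + e.2.1) k) x.j * tau (nib (10 + e.2.2) k) x.k *
      (if k &&& (x.f * 2 ^ 60) = 0 then 1 else 0) := by
  unfold trs tau
  rw [mask_eq]
  simp only [nib_testBit, Nat.and_or_distrib_left, Nat.or_eq_zero_iff, and_pow_zero]
  have hp : parOK (4 * e.1) (tab x.i) (4 * (5 + e.2.1)) (tab x.j) (4 * (10 + e.2.2)) (tab x.k) k =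
     decide (((tab x.i >>> nib e.1 k) + ((tab x.j >>> nib (5 + e.2.1) k) +
       (tab x.k >>> nib (10 + e.2.2) k))) % 2 = 0) := by
    rw [Bool.eq_iff_iff, decide_eq_true_eq]
    exact ⟨fun h => Nat.eq_of_beq_eq_true h, fun h => by
      show Nat.beq _ 0 = true
      exact (congrArg (fun z => Nat.beq z 0) h)⟩
  rw [hp]
  generalize tab x.i >>> nib e.1 k = A
  generalize tab x.j >>> nib (5 + e.2.1) k = B
  generalize tab x.k >>> nib (10 + e.2.2) k = C
  by_cases hf : k &&& (x.f * 2 ^ 60) = 0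
  · cases k.testBit (4 * e.1 + x.i) <;> cases k.testBit (4 * (5 + e.2.1) + x.j) <;>
      cases k.testBit (4 * (10 + e.2.2) + x.k) <;> simp only [hf, if_true, if_false,
        Bool.false_eq_true, true_and, false_and, and_true, and_false, mul_zero, zero_mul, mul_one,
        Bool.true_eq_false, decide_eq_true_eq]
    rcases Nat.mod_two_eq_zero_or_one A with hA | hA <;>
    rcases Nat.mod_two_eq_zero_or_one B with hB | hB <;>
    rcases Nat.mod_two_eq_zero_or_one C with hC | hC <;>
    simp [hA, hB, hC, Nat.add_mod]
  · simp only [hf, and_false, if_false, mul_zero]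

lemma slot_lemma (Ev : ℕ → ℕ × ℕ × ℕ) (A : ℕ → ℕ) (α : Ent → Fin 4) (P : ℕ → Prop)
    (G : Ent → Prop)
    (H : ∀ e u x, P u → G x → nib u (mask (Ev e) x) = if A e = u then 2 ^ (α x).val else 0)
    (Htr : ∀ e x k, trs (Ev e) x k ≠ 0 → (nib (A e) k).testBit (α x) = false) (m : ℕ) :
    ∀ f : Fin m → Ent, (∀ e, G (f e)) → Wt Ev m f ≠ 0 → ∀ u, P u → ∀ i,
      tau (nib u (key Ev m f)) i = ∏ e : Fin m, if A e = u then chi (α (f e)) i else 1 := by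
  induction m with
  | zero =>
    intro f _ _ u _ i
    simp only [key, Finset.univ_eq_empty, Finset.prod_empty]
    have : nib u 0 = 0 := by simp [nib]
    rw [this]; revert i; decide +kernel
  | succ m ih =>
    intro f hG hW u hu i
    rw [Wt] at hW
    have h1 := left_ne_zero_of_mul hW
    have h2 := Htr _ _ _ (right_ne_zero_of_mul hW)
    have h3 := ih _ (fun e => hG _) h1 u hu i
    rw [Fin.prod_univ_castSucc, key, nib_or, H _ _ _ hu (hG _)]
    simp only [Fin.val_castSucc, Fin.val_last]
    rw [← h3]
    by_cases hA : A m = u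
    · rw [hA] at h2
      simp only [hA, if_true]
      exact tau_or ⟨_, nib_lt _ _⟩ _ _ h2
    · simp [hA]

lemma sg_succ {m : ℕ} (a : ℕ → ℕ) (α : Fin (m + 1) → Fin 4) :
    sg a α = sg a (fun e => α e.castSucc) *
      ∏ e : Fin m, if a e = a m then chi (α e.castSucc) (α (Fin.last m)) else 1 := by
  unfold sg
  rw [Fin.prod_univ_castSucc]
  congr 1
  · refine Finset.prod_congr rfl fun e _ => ?_
    rw [Fin.prod_univ_castSucc]
    have : ¬ (Fin.last m < e.castSucc) := not_lt.mpr (Fin.le_last _)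
    simp [this]
  · rw [Fin.prod_univ_castSucc]
    simp [Fin.castSucc_lt_last]

/-- No flag is used twice. -/
def fok {m : ℕ} (f : Fin m → Ent) : Prop :=
  ∀ e e' : Fin m, e' < e → (f e').f &&& (f e).f = 0

open Classical in
lemma fok_succ {m : ℕ} (f : Fin (m + 1) → Ent) : fok f ↔ fok (fun e => f e.castSucc) ∧
    ∀ e : Fin m, (f e.castSucc).f &&& (f (Fin.last m)).f = 0 := by
  constructor
  · intro h
    exact ⟨fun e e' h' => h _ _ (by simpa using h'), fun e => h _ _ (Fin.castSucc_lt_last e)⟩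
  · rintro ⟨h1, h2⟩ e e' hl
    induction e using Fin.lastCases with
    | last =>
      induction e' using Fin.lastCases with
      | last => exact absurd hl (lt_irrefl _)
      | cast e' => exact h2 e'
    | cast e =>
      induction e' using Fin.lastCases with
      | last => exact absurd hl (not_lt.mpr (Fin.le_last _))
      | cast e' => exact h1 e e' (by simpa using hl)

lemma key_flag (Ev : ℕ → ℕ × ℕ × ℕ) (hE : ∀ e, (Ev e).1 < 5 ∧ (Ev e).2.1 < 5 ∧ (Ev e).2.2 < 5)
    {f0 : ℕ} (hf0 : okF f0) (m : ℕ) : ∀ f : Fin m → Ent, (∀ e, okF (f e).f) →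
    ((key Ev m f &&& (f0 * 2 ^ 60) = 0) ↔ ∀ e, (f e).f &&& f0 = 0) := by
  induction m with
  | zero => intro f _; simp [key]
  | succ m ih =>
    intro f hf
    rw [key, Nat.and_or_distrib_right, Nat.or_eq_zero_iff, ih _ (fun e => hf _), mask_eq]
    simp only [Nat.and_or_distrib_right, Nat.or_eq_zero_iff, flag_flag hf0 (hf _)]
    obtain ⟨h1, h2, h3⟩ := hE m
    have e1 := pow_flag hf0 ⟨(Ev m).1, by omega⟩ (f (Fin.last m)).i
    have e2 := pow_flag hf0 ⟨5 + (Ev m).2.1, by omega⟩ (f (Fin.last m)).j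
    have e3 := pow_flag hf0 ⟨10 + (Ev m).2.2, by omega⟩ (f (Fin.last m)).k
    simp only at e1 e2 e3
    simp only [e1, e2, e3, true_and]
    constructor
    · rintro ⟨h4, h5⟩ e
      induction e using Fin.lastCases with
      | last => exact h5
      | cast e => exact h4 e
    · intro h
      exact ⟨fun e => h _, h _⟩

open Classical in
lemma Wt_eq (a b c : ℕ → ℕ) (ha : ∀ e, a e < 5) (hb : ∀ e, b e < 5) (hc : ∀ e, c e < 5) (m : ℕ) :
    ∀ f : Fin m → Ent, (∀ e, okF (f e).f) →
    Wt (fun e => (a e, b e, c e)) m f = sg a (fun e => (f e).i) * sg b (fun e => (f e).j) *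
      sg c (fun e => (f e).k) * (if fok f then 1 else 0) := by
  set Ev : ℕ → ℕ × ℕ × ℕ := fun e => (a e, b e, c e) with hEv
  have htr : ∀ e x k, trs (Ev e) x k ≠ 0 → tau (nib (a e) k) x.i ≠ 0 ∧
      tau (nib (5 + b e) k) x.j ≠ 0 ∧ tau (nib (10 + c e) k) x.k ≠ 0 := by
    intro e x k h
    rw [trs_eq] at h
    have h1 := left_ne_zero_of_mul h
    exact ⟨left_ne_zero_of_mul (left_ne_zero_of_mul h1),
      right_ne_zero_of_mul (left_ne_zero_of_mul h1), right_ne_zero_of_mul h1⟩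
  have tb : ∀ x i, tau x i ≠ 0 → x.testBit i = false := by
    intro x i h
    by_contra h2
    rw [Bool.not_eq_false] at h2
    exact h (by rw [tau, if_pos h2])
  have hm : ∀ e u x, u < 15 → okF x.f → nib u (mask (Ev e) x) =
      (if a e = u then 2 ^ x.i.val else 0) ||| ((if 5 + b e = u then 2 ^ x.j.val else 0) |||
        ((if 10 + c e = u then 2 ^ x.k.val else 0) ||| 0)) := by
    intro e u x hu hx
    have := ha e
    have := hb e
    have := hc e
    rw [mask_eq, nib_or, nib_or, nib_or]
    have e1 := nib_pow ⟨u, hu⟩ ⟨a e, by omega⟩ x.i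
    have e2 := nib_pow ⟨u, hu⟩ ⟨5 + b e, by omega⟩ x.j
    have e3 := nib_pow ⟨u, hu⟩ ⟨10 + c e, by omega⟩ x.k
    have e4 := nib_flag hx ⟨u, hu⟩
    simp only at e1 e2 e3 e4
    simp only [hEv, e1, e2, e3, e4]
  have sA := slot_lemma Ev a Ent.i (fun u => u < 5) (fun x => okF x.f)
    (by
      intro e u x hu hx
      have := ha e
      rw [hm e u x (by omega) hx, if_neg (show ¬ 5 + b e = u by omega),
        if_neg (show ¬ 10 + c e = u by omega)]
      simp) (fun e x k h => tb _ _ (htr e x k h).1)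
  have sB := slot_lemma Ev (fun e => 5 + b e) Ent.j (fun u => 5 ≤ u ∧ u < 10) (fun x => okF x.f)
    (by
      intro e u x hu hx
      have := ha e
      rw [hm e u x (by omega) hx, if_neg (show ¬ a e = u by omega),
        if_neg (show ¬ 10 + c e = u by omega)]
      simp) (fun e x k h => tb _ _ (htr e x k h).2.1)
  have sC := slot_lemma Ev (fun e => 10 + c e) Ent.k (fun u => 10 ≤ u ∧ u < 15) (fun x => okF x.f)
    (by
      intro e u x hu hx
      have := ha e
      have := hb e
      rw [hm e u x (by omega) hx, if_neg (show ¬ a e = u by omega),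
        if_neg (show ¬ 5 + b e = u by omega)]
      simp) (fun e x k h => tb _ _ (htr e x k h).2.2)
  induction m with
  | zero =>
    intro f _
    have : fok f := fun e => e.elim0
    simp [Wt, sg, this]
  | succ m ih =>
    intro f hf
    rw [Wt, sg_succ, sg_succ, sg_succ, fok_succ]
    have h0 := ih (fun e => f e.castSucc) (fun e => hf _)
    by_cases hW : Wt Ev m (fun e => f e.castSucc) = 0
    · rw [hW, zero_mul]
      rw [hW] at h0
      by_cases hk : fok (fun e : Fin m => f e.castSucc)
      · rw [if_pos hk, mul_one] at h0
        by_cases hq : ∀ e : Fin m, (f e.castSucc).f &&& (f (Fin.last m)).f = 0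
        · rw [if_pos ⟨hk, hq⟩]
          linear_combination (((∏ e : Fin m, if a e = a m then chi (f e.castSucc).i
            (f (Fin.last m)).i else 1) * (∏ e : Fin m, if b e = b m then chi (f e.castSucc).j
            (f (Fin.last m)).j else 1) * (∏ e : Fin m, if c e = c m then chi (f e.castSucc).k
            (f (Fin.last m)).k else 1))) * h0
        · rw [if_neg (fun h => hq h.2), mul_zero]
      · rw [if_neg (fun h => hk h.1), mul_zero]
    · have tA := sA m _ (fun e => hf _) hW (a m) (ha m) (f (Fin.last m)).i
      have tB := sB m _ (fun e => hf _) hW (5 + b m) ⟨by omega, by have := hb m; omega⟩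
        (f (Fin.last m)).j
      have tC := sC m _ (fun e => hf _) hW (10 + c m) ⟨by omega, by have := hc m; omega⟩
        (f (Fin.last m)).k
      simp only [add_right_inj] at tA tB tC
      rw [trs_eq]
      simp only [hEv] at h0 tA tB tC ⊢
      rw [tA, tB, tC, h0]
      simp only [key_flag (fun e => (a e, b e, c e)) (fun e => ⟨ha e, hb e, hc e⟩)
        (hf (Fin.last m)) m (fun e => f e.castSucc) (fun e => hf _)]
      by_cases hk : fok (fun e : Fin m => f e.castSucc)
      · by_cases hq : ∀ e : Fin m, (f e.castSucc).f &&& (f (Fin.last m)).f = 0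
        · rw [if_pos hk, if_pos hq, if_pos ⟨hk, hq⟩]; ring
        · rw [if_neg hq, if_neg (fun h : _ ∧ _ => hq h.2)]; ring
      · rw [if_neg hk, if_neg (fun h : _ ∧ _ => hk h.1)]; ring


/-! ### Counting, expansion, packing -/

lemma sg_count {a : ℕ → ℕ} (ha : Reg a) (α : Fin 20 → Fin 4) (h : sg a α ≠ 0) (i : Fin 4) :
    ∑ e, (if α e = i then 1 else 0) = 5 := by
  obtain ⟨σ, h1, h2⟩ := ha
  rw [sg_eq a σ h1 h2, Finset.prod_ne_zero_iff] at h
  rw [← σ.sum_comp, Fintype.sum_prod_type]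
  have : ∀ v : Fin 5, ∑ s, (if α (σ (v, s)) = i then 1 else 0) = 1 := by
    intro v
    have hi : Function.Injective (fun s => α (σ (v, s))) := by
      by_contra hn
      exact h v (Finset.mem_univ _) (eps4_zero _ hn)
    obtain ⟨s, hs⟩ := (Finite.injective_iff_surjective.mp hi) i
    rw [Finset.sum_eq_single s]
    · simp only at hs; simp [hs]
    · intro b _ hb
      rw [if_neg]
      intro h3
      exact hb (hi (h3.trans hs.symm))
    · simp
  simp [this]

lemma sg_abs {m : ℕ} (a : ℕ → ℕ) (α : Fin m → Fin 4) : |sg a α| ≤ 1 := by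
  unfold sg
  rw [Finset.abs_prod]
  refine Finset.prod_le_one (fun _ _ => abs_nonneg _) fun e _ => ?_
  rw [Finset.abs_prod]
  refine Finset.prod_le_one (fun _ _ => abs_nonneg _) fun e' _ => ?_
  split_ifs
  · have : ∀ x y : Fin 4, |chi x y| ≤ 1 := by decide +kernel
    exact this _ _
  · simp

/-- The tensor with given entries. -/
def tenOf {R : Type*} [CommRing R] {n : ℕ} (E : Fin n → Ent) (x : Fin n → R) : Ten R :=
  fun i j k => ∑ q, if i = (E q).i ∧ j = (E q).j ∧ k = (E q).k then x q else 0

/-- The sign of a choice of entries. -/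
def sgn3 {n : ℕ} (a b c : ℕ → ℕ) (E : Fin n → Ent) (l : Fin 20 → Fin n) : ℤ :=
  sg a (fun e => (E (l e)).i) * sg b (fun e => (E (l e)).j) * sg c (fun e => (E (l e)).k)

lemma DD_expand {R : Type*} [CommRing R] {n : ℕ} (a b c : ℕ → ℕ) (E : Fin n → Ent) (x : Fin n → R) :
    DD a b c (tenOf E x) = ∑ l : Fin 20 → Fin n, ((sgn3 a b c E l : ℤ) : R) * ∏ e, x (l e) := by
  classical
  have h1 : ∀ α β γ : Fin 20 → Fin 4, ∏ e, tenOf E x (α e) (β e) (γ e) =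
      ∑ l : Fin 20 → Fin n, if α = (fun e => (E (l e)).i) ∧ β = (fun e => (E (l e)).j) ∧
        γ = (fun e => (E (l e)).k) then ∏ e, x (l e) else 0 := by
    intro α β γ
    unfold tenOf
    rw [Finset.prod_univ_sum, Fintype.piFinset_univ]
    refine Finset.sum_congr rfl fun l _ => ?_
    split_ifs with h
    · obtain ⟨rfl, rfl, rfl⟩ := h
      simp
    · have : ∃ e, ¬ (α e = (E (l e)).i ∧ β e = (E (l e)).j ∧ γ e = (E (l e)).k) := by
        by_contra h2
        push Not at h2
        exact h ⟨funext fun e => (h2 e).1, funext fun e => (h2 e).2.1, funext fun e => (h2 e).2.2⟩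
      obtain ⟨e, he⟩ := this
      exact Finset.prod_eq_zero (Finset.mem_univ e) (if_neg he)
  unfold DD
  simp only [h1, Finset.mul_sum, mul_ite, mul_zero]
  have : ∀ α β : Fin 20 → Fin 4, ∑ γ : Fin 20 → Fin 4, ∑ l : Fin 20 → Fin n,
      (if α = (fun e => (E (l e)).i) ∧ β = (fun e => (E (l e)).j) ∧
        γ = (fun e => (E (l e)).k) then
        ((sg a α : ℤ) : R) * ((sg b β : ℤ) : R) * ((sg c γ : ℤ) : R) * ∏ e, x (l e) else 0) =
      ∑ l : Fin 20 → Fin n, (if α = (fun e => (E (l e)).i) ∧ β = (fun e => (E (l e)).j) then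
        ((sg a α : ℤ) : R) * ((sg b β : ℤ) : R) * ((sg c (fun e => (E (l e)).k) : ℤ) : R) *
          ∏ e, x (l e) else 0) := by
    intro α β
    rw [Finset.sum_comm]
    refine Finset.sum_congr rfl fun l _ => ?_
    simp only [← and_assoc]
    by_cases h : α = (fun e => (E (l e)).i) ∧ β = (fun e => (E (l e)).j)
    · simp [h]
    · simp [h]
  simp only [this]
  have : ∀ α : Fin 20 → Fin 4, ∑ β : Fin 20 → Fin 4, ∑ l : Fin 20 → Fin n,
      (if α = (fun e => (E (l e)).i) ∧ β = (fun e => (E (l e)).j) then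
        ((sg a α : ℤ) : R) * ((sg b β : ℤ) : R) * ((sg c (fun e => (E (l e)).k) : ℤ) : R) *
          ∏ e, x (l e) else 0) =
      ∑ l : Fin 20 → Fin n, (if α = (fun e => (E (l e)).i) then
        ((sg a α : ℤ) : R) * ((sg b (fun e => (E (l e)).j) : ℤ) : R) *
          ((sg c (fun e => (E (l e)).k) : ℤ) : R) * ∏ e, x (l e) else 0) := by
    intro α
    rw [Finset.sum_comm]
    refine Finset.sum_congr rfl fun l _ => ?_
    by_cases h : α = (fun e => (E (l e)).i)
    · simp [h]
    · simp [h]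
  simp only [this]
  rw [Finset.sum_comm]
  refine Finset.sum_congr rfl fun l _ => ?_
  simp [sgn3]

lemma pack_aux (B : ℤ) (M : ℕ) : ∀ d : ℕ → ℤ, (∀ n, |d n| < B) →
    ∑ n ∈ Finset.range M, d n * B ^ n = 0 → ∀ n < M, d n = 0 := by
  induction M with
  | zero => intro d _ _ n hn; omega
  | succ M ih =>
    intro d hd h
    have hB : 0 < B := lt_of_le_of_lt (abs_nonneg _) (hd 0)
    rw [Finset.sum_range_succ'] at h
    have h2 : ∑ n ∈ Finset.range M, d (n + 1) * B ^ (n + 1) =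
        B * ∑ n ∈ Finset.range M, d (n + 1) * B ^ n := by
      rw [Finset.mul_sum]
      exact Finset.sum_congr rfl fun n _ => by ring
    rw [h2] at h
    have h0 : d 0 = 0 := by
      apply Int.eq_zero_of_abs_lt_dvd (m := B) _ (hd 0)
      exact ⟨-∑ n ∈ Finset.range M, d (n + 1) * B ^ n, by linear_combination h⟩
    rw [h0, zero_mul, add_zero] at h
    have h3 := ih (fun n => d (n + 1)) (fun n => hd _) ((mul_eq_zero.mp h).resolve_left hB.ne')
    intro n hn
    cases n with
    | zero => exact h0
    | succ n => exact h3 n (by omega)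

lemma packing {ι R : Type*} [Fintype ι] [CommRing R] (B : ℤ) (c : ι → ℤ) (W : ι → ℕ)
    (hB : ∑ i, |c i| < B) (h : ∑ i, c i * B ^ W i = 0) (φ : ℕ → R) :
    ∑ i, ((c i : ℤ) : R) * φ (W i) = 0 := by
  classical
  set M := ∑ i, W i + 1 with hM
  have hW : ∀ i, W i ∈ Finset.range M := by
    intro i
    have := Finset.single_le_sum (f := W) (fun _ _ => Nat.zero_le _) (Finset.mem_univ i)
    rw [Finset.mem_range]; omega
  set d : ℕ → ℤ := fun n => ∑ i ∈ Finset.univ.filter (fun i => W i = n), c i with hd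
  have hd2 : ∀ n, |d n| < B := by
    intro n
    refine lt_of_le_of_lt ((Finset.abs_sum_le_sum_abs _ _).trans ?_) hB
    exact Finset.sum_le_sum_of_subset_of_nonneg (Finset.filter_subset _ _)
      (fun _ _ _ => abs_nonneg _)
  have hz := pack_aux B M d hd2 (by
    rw [← h, ← Finset.sum_fiberwise_of_maps_to (g := W) (t := Finset.range M) (fun i _ => hW i)]
    refine Finset.sum_congr rfl fun n _ => ?_
    rw [hd, Finset.sum_mul]
    refine Finset.sum_congr rfl fun i hi => ?_
    rw [(Finset.mem_filter.mp hi).2])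
  rw [← Finset.sum_fiberwise_of_maps_to (g := W) (t := Finset.range M) (fun i _ => hW i)]
  refine Finset.sum_eq_zero fun n hn => ?_
  have : ∑ i ∈ Finset.univ.filter (fun i => W i = n), ((c i : ℤ) : R) * φ (W i) =
      ((d n : ℤ) : R) * φ n := by
    rw [hd]
    push_cast
    rw [Finset.sum_mul]
    refine Finset.sum_congr rfl fun i hi => ?_
    rw [(Finset.mem_filter.mp hi).2]
  rw [this, hz n (Finset.mem_range.mp hn)]
  simp

lemma prod_single {R : Type*} [CommRing R] {m : ℕ} (h : ℕ → R) (h0 : h 0 = 1) (s : Fin m → ℕ)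
    (hs : ∀ e e' : Fin m, e' < e → s e' = 0 ∨ s e = 0) : ∏ e, h (s e) = h (∑ e, s e) := by
  by_cases hz : ∀ e, s e = 0
  · simp [hz, h0]
  · push Not at hz
    obtain ⟨e0, he⟩ := hz
    have hr : ∀ e, e ≠ e0 → s e = 0 := by
      intro e hne
      rcases lt_or_gt_of_ne hne with h1 | h1
      · exact (hs e0 e h1).resolve_right he
      · exact (hs e e0 h1).resolve_left he
    rw [Finset.prod_eq_single e0, Finset.sum_eq_single e0]
    · intro e _ h1; exact hr e h1
    · simp
    · intro e _ h1; rw [hr e h1, h0]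
    · simp


/-! ### The two designs and the tensors on which they are evaluated -/

def fam0 : ET := .node (.leaf 0 0 0 0) (.leaf 3 3 1 0)
def fam1 : ET := .node (.node (.leaf 0 1 2 36) (.node (.leaf 0 3 2 72) (.leaf 1 0 4 252))) (.node (.node (.leaf 3 0 4 504) (.leaf 1 1 0 0)) (.node (.leaf 2 3 0 0) (.leaf 3 2 0 0)))
def fam2 : ET := .node (.node (.leaf 0 1 2 108) (.node (.leaf 0 2 2 144) (.leaf 1 0 4 756))) (.node (.node (.leaf 2 0 4 1008) (.leaf 1 3 0 1)) (.node (.leaf 2 2 0 0) (.leaf 3 1 0 0)))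
def fam3 : ET := .node (.node (.leaf 0 2 2 180) (.node (.leaf 0 3 2 216) (.leaf 2 0 4 1260))) (.node (.node (.leaf 3 0 4 1512) (.leaf 1 2 0 6)) (.node (.leaf 2 1 0 0) (.leaf 3 3 0 0)))
def fam (i : Fin 4) : ET := Fin.cases fam0 (fun i => Fin.cases fam1 (fun i => Fin.cases fam2 (fun _ => fam3) i) i) i

def wit0 : ET := .node (.node (.leaf 0 2 0 0) (.leaf 1 2 0 0)) (.node (.leaf 2 1 0 0) (.leaf 3 0 0 0))
def wit1 : ET := .node (.leaf 0 1 0 0) (.leaf 1 0 0 0)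
def wit2 : ET := .node (.leaf 0 2 0 0) (.leaf 1 3 0 0)
def wit3 : ET := .node (.leaf 1 0 0 0) (.node (.leaf 2 2 0 0) (.leaf 3 3 0 0))
def wit (i : Fin 4) : ET := Fin.cases wit0 (fun i => Fin.cases wit1 (fun i => Fin.cases wit2 (fun _ => wit3) i) i) i

def la0 : List ℕ := [1, 3, 3, 1, 1, 3, 0, 0, 0, 3, 0, 4, 1, 4, 4, 4, 2, 2, 2, 2]
def lb0 : List ℕ := [2, 2, 2, 2, 4, 4, 4, 4, 0, 0, 0, 0, 3, 3, 3, 1, 3, 1, 1, 1]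
def lc0 : List ℕ := [4, 4, 2, 2, 2, 2, 4, 0, 4, 0, 0, 3, 3, 3, 1, 1, 1, 0, 1, 3]
def d0 : List (ℕ × ℕ × ℕ) := [(1, 2, 4), (3, 2, 4), (3, 2, 2), (1, 2, 2), (1, 4, 2), (3, 4, 2), (0, 4, 4), (0, 4, 0), (0, 0, 4), (3, 0, 0), (0, 0, 0), (4, 0, 3), (1, 3, 3), (4, 3, 3), (4, 3, 1), (4, 1, 1), (2, 3, 1), (2, 1, 0), (2, 1, 1), (2, 1, 3)]
def ev0 (e : ℕ) : ℕ × ℕ × ℕ := (vx la0 e, vx lb0 e, vx lc0 e)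
lemma d0_eq : (List.range 20).map ev0 = d0 := by decide +kernel
lemma reg_a0 : Reg (vx la0) :=
  Reg.of_slots (s := [[6, 7, 8, 10], [0, 3, 4, 12], [16, 17, 18, 19], [1, 2, 5, 9], [11, 13, 14, 15]])
    (by unfold reg_of_slots; decide +kernel)
lemma lt_a0 (e : ℕ) : vx la0 e < 5 := by
  by_cases h : e < 20
  · exact (show ∀ e : Fin 20, vx la0 e < 5 by decide +kernel) ⟨e, h⟩
  · unfold vx
    rw [List.getD_eq_default _ _ (by simpa [la0] using h)]
    norm_num
lemma reg_b0 : Reg (vx lb0) :=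
  Reg.of_slots (s := [[8, 9, 10, 11], [15, 17, 18, 19], [0, 1, 2, 3], [12, 13, 14, 16], [4, 5, 6, 7]])
    (by unfold reg_of_slots; decide +kernel)
lemma lt_b0 (e : ℕ) : vx lb0 e < 5 := by
  by_cases h : e < 20
  · exact (show ∀ e : Fin 20, vx lb0 e < 5 by decide +kernel) ⟨e, h⟩
  · unfold vx
    rw [List.getD_eq_default _ _ (by simpa [lb0] using h)]
    norm_num
lemma reg_c0 : Reg (vx lc0) :=
  Reg.of_slots (s := [[7, 9, 10, 17], [14, 15, 16, 18], [2, 3, 4, 5], [11, 12, 13, 19], [0, 1, 6, 8]])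
    (by unfold reg_of_slots; decide +kernel)
lemma lt_c0 (e : ℕ) : vx lc0 e < 5 := by
  by_cases h : e < 20
  · exact (show ∀ e : Fin 20, vx lc0 e < 5 by decide +kernel) ⟨e, h⟩
  · unfold vx
    rw [List.getD_eq_default _ _ (by simpa [lc0] using h)]
    norm_num

def la3 : List ℕ := [0, 0, 0, 0, 1, 1, 1, 1, 2, 4, 4, 2, 4, 2, 3, 3, 3, 2, 3, 4]
def lb3 : List ℕ := [1, 1, 1, 4, 1, 4, 4, 2, 4, 2, 2, 2, 0, 0, 0, 3, 0, 3, 3, 3]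
def lc3 : List ℕ := [2, 3, 4, 3, 3, 3, 2, 2, 4, 2, 4, 4, 0, 0, 0, 0, 1, 1, 1, 1]
def d3 : List (ℕ × ℕ × ℕ) := [(0, 1, 2), (0, 1, 3), (0, 1, 4), (0, 4, 3), (1, 1, 3), (1, 4, 3), (1, 4, 2), (1, 2, 2), (2, 4, 4), (4, 2, 2), (4, 2, 4), (2, 2, 4), (4, 0, 0), (2, 0, 0), (3, 0, 0), (3, 3, 0), (3, 0, 1), (2, 3, 1), (3, 3, 1), (4, 3, 1)]
def ev3 (e : ℕ) : ℕ × ℕ × ℕ := (vx la3 e, vx lb3 e, vx lc3 e)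
lemma d3_eq : (List.range 20).map ev3 = d3 := by decide +kernel
lemma reg_a3 : Reg (vx la3) :=
  Reg.of_slots (s := [[0, 1, 2, 3], [4, 5, 6, 7], [8, 11, 13, 17], [14, 15, 16, 18], [9, 10, 12, 19]])
    (by unfold reg_of_slots; decide +kernel)
lemma lt_a3 (e : ℕ) : vx la3 e < 5 := by
  by_cases h : e < 20
  · exact (show ∀ e : Fin 20, vx la3 e < 5 by decide +kernel) ⟨e, h⟩
  · unfold vx
    rw [List.getD_eq_default _ _ (by simpa [la3] using h)]
    norm_num
lemma reg_b3 : Reg (vx lb3) :=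
  Reg.of_slots (s := [[12, 13, 14, 16], [0, 1, 2, 4], [7, 9, 10, 11], [15, 17, 18, 19], [3, 5, 6, 8]])
    (by unfold reg_of_slots; decide +kernel)
lemma lt_b3 (e : ℕ) : vx lb3 e < 5 := by
  by_cases h : e < 20
  · exact (show ∀ e : Fin 20, vx lb3 e < 5 by decide +kernel) ⟨e, h⟩
  · unfold vx
    rw [List.getD_eq_default _ _ (by simpa [lb3] using h)]
    norm_num
lemma reg_c3 : Reg (vx lc3) :=
  Reg.of_slots (s := [[12, 13, 14, 15], [16, 17, 18, 19], [0, 6, 7, 9], [1, 3, 4, 5], [2, 8, 10, 11]])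
    (by unfold reg_of_slots; decide +kernel)
lemma lt_c3 (e : ℕ) : vx lc3 e < 5 := by
  by_cases h : e < 20
  · exact (show ∀ e : Fin 20, vx lc3 e < 5 by decide +kernel) ⟨e, h⟩
  · unfold vx
    rw [List.getD_eq_default _ _ (by simpa [lc3] using h)]
    norm_num

def SL.scale (x y : ℕ) (L : SL) : SL :=
  SL.rec SL.nil (fun k p n _ ih => SL.cons k (x * p + y * n) (x * n + y * p) ih) L

def SL.ok (L : SL) : Bool :=
  SL.rec true (fun _ p n _ ih => Bool.rec false ih (Nat.beq p n)) L

def SL.tot (L : SL) : ℕ × ℕ :=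
  SL.rec (0, 0) (fun _ p n _ ih => (p + ih.1, n + ih.2)) L

lemma val_scale (x y : ℕ) (g : ℕ → ℤ) (L : SL) : (L.scale x y).val g = (x - y : ℤ) * L.val g := by
  induction L with
  | nil => simp [SL.scale, SL.val]
  | cons k p n t ih =>
    have : (SL.cons k p n t).scale x y = SL.cons k (x * p + y * n) (x * n + y * p) (t.scale x y) :=
      rfl
    rw [this, SL.val, SL.val, ih]; push_cast; ring

lemma val_ok (g : ℕ → ℤ) (L : SL) (h : L.ok = true) : L.val g = 0 := by
  induction L with
  | nil => rfl
  | cons k p n t ih =>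
    have h1 : (SL.cons k p n t).ok = Bool.rec false t.ok (Nat.beq p n) := rfl
    rw [h1] at h
    cases hb : Nat.beq p n
    · rw [hb] at h; exact absurd h (by simp)
    · rw [hb] at h
      rw [SL.val, ih h, Nat.eq_of_beq_eq_true hb]; ring

lemma val_tot (L : SL) : L.val (fun _ => 1) = (L.tot.1 : ℤ) - L.tot.2 := by
  induction L with
  | nil => rfl
  | cons k p n t ih =>
    have h1 : (SL.cons k p n t).tot = (p + t.tot.1, n + t.tot.2) := rfl
    rw [h1, SL.val, ih]; push_cast; ring

def start : SL := .cons 0 1 0 .nil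

theorem big_check : (SL.merge (SL.scale 10 0 (run 96 fam d0 start))
    (SL.scale 0 3 (run 96 fam d3 start))).ok = true := by decide +kernel

theorem small_check0 : (run 0 wit d0 start).tot = (158400, 184320) := by decide +kernel
theorem small_check3 : (run 0 wit d3 start).tot = (50432, 568832) := by decide +kernel


/-! ### The invariant vanishes on the normal form -/

/-- The invariant of degree 20. -/
def II {R : Type*} [CommRing R] (T : Ten R) : R :=
  10 * DD (vx la0) (vx lb0) (vx lc0) T - 3 * DD (vx la3) (vx lb3) (vx lc3) T

def ents (E : Fin 4 → ET) : Fin (entL E).length → Ent := (entL E).get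

open Classical in
lemma run_sum0 (N : ℕ) (E : Fin 4 → ET) (hE : ∀ q, okF (ents E q).f) :
    (run N E d0 start).val (fun _ => 1) = ∑ l : Fin 20 → Fin (entL E).length,
      sgn3 (vx la0) (vx lb0) (vx lc0) (ents E) l * (if fok (fun e => ents E (l e)) then 1 else 0) *
        (2 ^ N) ^ (∑ e, (ents E (l e)).w) := by
  rw [← d0_eq, start, run_val]
  refine Finset.sum_congr rfl fun l _ => ?_
  have := Wt_eq (vx la0) (vx lb0) (vx lc0) lt_a0 lt_b0 lt_c0 20 (fun e => ents E (l e))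
    (fun e => hE _)
  rw [mul_one, pow_mul, sgn3, ← this]
  rfl

open Classical in
lemma run_sum3 (N : ℕ) (E : Fin 4 → ET) (hE : ∀ q, okF (ents E q).f) :
    (run N E d3 start).val (fun _ => 1) = ∑ l : Fin 20 → Fin (entL E).length,
      sgn3 (vx la3) (vx lb3) (vx lc3) (ents E) l * (if fok (fun e => ents E (l e)) then 1 else 0) *
        (2 ^ N) ^ (∑ e, (ents E (l e)).w) := by
  rw [← d3_eq, start, run_val]
  refine Finset.sum_congr rfl fun l _ => ?_
  have := Wt_eq (vx la3) (vx lb3) (vx lc3) lt_a3 lt_b3 lt_c3 20 (fun e => ents E (l e))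
    (fun e => hE _)
  rw [mul_one, pow_mul, sgn3, ← this]
  rfl

lemma entL_wit : entL wit = (wit0.toL 0 ++ wit1.toL 1) ++ (wit2.toL 2 ++ wit3.toL 3) := rfl

lemma wit_flag : ∀ q, (ents wit q).f = 0 ∧ (ents wit q).w = 0 := by
  have : ∀ x ∈ entL wit, x.f = 0 ∧ x.w = 0 := by
    simp [entL_wit, wit0, wit1, wit2, wit3, ET.toL]
  exact fun q => this _ (List.get_mem _ _)

/-- The invariant is not identically zero. -/
lemma II_wit : II (tenOf (R := ℂ) (ents wit) (fun _ => 1)) ≠ 0 := by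
  have hf : ∀ q, okF (ents wit q).f := fun q => Or.inl (wit_flag q).1
  have hk : ∀ l : Fin 20 → Fin (entL wit).length, fok (fun e => ents wit (l e)) := by
    intro l e e' _
    simp [(wit_flag _).1]
  have h0 := run_sum0 0 wit hf
  have h3 := run_sum3 0 wit hf
  rw [val_tot, small_check0] at h0
  rw [val_tot, small_check3] at h3
  simp only [hk, if_true, pow_zero, one_pow, mul_one] at h0 h3
  rw [II, DD_expand, DD_expand]
  simp only [Finset.prod_const_one, mul_one]
  rw [← Int.cast_sum, ← Int.cast_sum, ← h0, ← h3]
  norm_num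

lemma entL_fam : entL fam = (fam0.toL 0 ++ fam1.toL 1) ++ (fam2.toL 2 ++ fam3.toL 3) := rfl

lemma fam_facts : ∀ x ∈ entL fam, okF x.f ∧
    x.w = x.w % 6 + 6 * (x.w / 6 % 6) + 36 * (x.w / 36 % 7) + 252 * (x.w / 252) ∧
    x.w % 6 ≤ (if x.j = 1 then 1 else 0) ∧ x.w / 6 % 6 ≤ (if x.j = 1 then 1 else 0) ∧
    x.w / 36 % 7 ≤ 6 * (if x.f = 2 then 1 else 0) ∧
    (if x.f = 4 then 1 else 0) ≤ x.w / 252 ∧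
    x.w / 252 ≤ 6 * (if x.f = 4 then 1 else 0) ∧
    (if x.i = 0 then 1 else 0) + (if x.f = 2 then 1 else 0) =
      (if x.j = 0 then 1 else 0) + (if x.f = 1 then 1 else 0) ∧
    (if x.i = 0 then 1 else 0) + (if x.f = 4 then 1 else 0) =
      (if x.k = 0 then 1 else 0) + (if x.f = 1 then 1 else 0) := by
  simp [entL_fam, fam0, fam1, fam2, fam3, ET.toL, okF]

lemma fam_len : (entL fam).length = 23 := by
  simp [entL_fam, fam0, fam1, fam2, fam3, ET.toL]

section
variable {R : Type*} [CommRing R] (k1 k2 δ : R) (qv rv : ℕ → R)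

/-- The value of an entry of the normal form. -/
def xval (x : Ent) : R :=
  k1 ^ (x.w % 6) * k2 ^ (x.w / 6 % 6) * qv (x.w / 36 % 7) * rv (x.w / 252) *
    δ ^ (if x.f = 1 then 1 else 0)

/-- The monomial attached to a weight. -/
def phi (W : ℕ) : R :=
  k1 ^ (W % 6) * k2 ^ (W / 6 % 6) * qv (W / 36 % 7) * rv (W / 252) *
    δ ^ (if W / 252 = 0 then 0 else 1)

open Classical in
set_option maxHeartbeats 1000000 in
lemma term_eq (hδ : δ * δ = 0) (hq : qv 0 = 1) (hr : rv 0 = 1) {a b c : ℕ → ℕ} (ha : Reg a)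
    (hb : Reg b) (hc : Reg c) (l : Fin 20 → Fin (entL fam).length) :
    ((sgn3 a b c (ents fam) l : ℤ) : R) * ∏ e, xval k1 k2 δ qv rv (ents fam (l e)) =
    ((sgn3 a b c (ents fam) l : ℤ) : R) * ((if fok (fun e => ents fam (l e)) then 1 else 0) *
      phi k1 k2 δ qv rv (∑ e, (ents fam (l e)).w)) := by
  by_cases hs : sgn3 a b c (ents fam) l = 0
  · simp [hs]
  congr 1
  unfold sgn3 at hs
  set x : Fin 20 → Ent := fun e => ents fam (l e) with hx
  have hsA := left_ne_zero_of_mul (left_ne_zero_of_mul hs)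
  have hsB := right_ne_zero_of_mul (left_ne_zero_of_mul hs)
  have hsC := right_ne_zero_of_mul hs
  have F : ∀ e, _ := fun e => fam_facts (x e) (List.get_mem _ _)
  have cA := sg_count ha _ hsA 0
  have cB := sg_count hb _ hsB 0
  have cB1 := sg_count hb _ hsB 1
  have cC := sg_count hc _ hsC 0
  change ∑ e, (if (x e).i = 0 then 1 else 0) = 5 at cA
  change ∑ e, (if (x e).j = 0 then 1 else 0) = 5 at cB
  change ∑ e, (if (x e).j = 1 then 1 else 0) = 5 at cB1
  change ∑ e, (if (x e).k = 0 then 1 else 0) = 5 at cC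
  set nP := ∑ e, (if (x e).f = 1 then 1 else 0) with hnP
  set nQ := ∑ e, (if (x e).f = 2 then 1 else 0) with hnQ
  set nR := ∑ e, (if (x e).f = 4 then 1 else 0) with hnR
  set N1 := ∑ e, (x e).w % 6 with hN1
  set N2 := ∑ e, (x e).w / 6 % 6 with hN2
  set NA := ∑ e, (x e).w / 36 % 7 with hNA
  set NB := ∑ e, (x e).w / 252 with hNB
  have hW : ∑ e, (x e).w = N1 + 6 * N2 + 36 * NA + 252 * NB := by
    rw [hN1, hN2, hNA, hNB, Finset.mul_sum, Finset.mul_sum, Finset.mul_sum,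
      ← Finset.sum_add_distrib, ← Finset.sum_add_distrib, ← Finset.sum_add_distrib]
    exact Finset.sum_congr rfl fun e _ => (F e).2.1
  have b1 : N1 ≤ 5 := cB1 ▸ Finset.sum_le_sum fun e _ => (F e).2.2.1
  have b2 : N2 ≤ 5 := cB1 ▸ Finset.sum_le_sum fun e _ => (F e).2.2.2.1
  have b3 : NA ≤ 6 * nQ := by
    rw [hnQ, Finset.mul_sum]; exact Finset.sum_le_sum fun e _ => (F e).2.2.2.2.1
  have b4 : nR ≤ NB := Finset.sum_le_sum fun e _ => (F e).2.2.2.2.2.1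
  have b5 : NB ≤ 6 * nR := by
    rw [hnR, Finset.mul_sum]; exact Finset.sum_le_sum fun e _ => (F e).2.2.2.2.2.2.1
  have b6 : 5 + nQ = 5 + nP := by
    rw [← cA, hnQ, ← Finset.sum_add_distrib, cA, ← cB, hnP, ← Finset.sum_add_distrib]
    exact Finset.sum_congr rfl fun e _ => (F e).2.2.2.2.2.2.2.1
  have b7 : 5 + nR = 5 + nP := by
    rw [← cA, hnR, ← Finset.sum_add_distrib, cA, ← cC, hnP, ← Finset.sum_add_distrib]
    exact Finset.sum_congr rfl fun e _ => (F e).2.2.2.2.2.2.2.2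
  have hprod : ∏ e, xval k1 k2 δ qv rv (x e) = k1 ^ N1 * k2 ^ N2 * (∏ e, qv ((x e).w / 36 % 7)) *
      (∏ e, rv ((x e).w / 252)) * δ ^ nP := by
    simp only [xval, Finset.prod_mul_distrib, Finset.prod_pow_eq_pow_sum]
    rfl
  have card1 : ∀ v : ℕ, ∀ e e' : Fin 20, e' < e → (x e).f = v → (x e').f = v →
      2 ≤ ∑ e, (if (x e).f = v then 1 else 0) := by
    intro v e e' hl h1 h2
    have : ∑ e ∈ ({e', e} : Finset (Fin 20)), (if (x e).f = v then 1 else 0) ≤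
        ∑ e, (if (x e).f = v then 1 else 0) :=
      Finset.sum_le_sum_of_subset (Finset.subset_univ _)
    rw [Finset.sum_pair hl.ne, if_pos h1, if_pos h2] at this
    exact this
  rw [hprod]
  by_cases hP : nP ≤ 1
  · have hfok : fok x := by
      intro e e' hl
      by_contra hne
      rcases (F e).1 with h1 | h1 | h1 | h1 <;> rcases (F e').1 with h2 | h2 | h2 | h2 <;>
        rw [h1, h2] at hne <;> first | exact hne (by decide) | skip
      · have := card1 1 e e' hl h1 h2; omega
      · have := card1 2 e e' hl h1 h2; omega
      · have := card1 4 e e' hl h1 h2; omega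
    rw [if_pos hfok, one_mul, prod_single qv hq _ (by
      intro e e' hl
      by_contra hne
      push Not at hne
      have h1 := (F e).2.2.2.2.1
      have h2 := (F e').2.2.2.2.1
      have h3 : (x e).f = 2 := by by_contra h; rw [if_neg h] at h1; omega
      have h4 : (x e').f = 2 := by by_contra h; rw [if_neg h] at h2; omega
      have := card1 2 e e' hl h3 h4; omega), prod_single rv hr _ (by
      intro e e' hl
      by_contra hne
      push Not at hne
      have h1 := (F e).2.2.2.2.2.2.1
      have h2 := (F e').2.2.2.2.2.2.1
      have h3 : (x e).f = 4 := by by_contra h; rw [if_neg h] at h1; omega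
      have h4 : (x e').f = 4 := by by_contra h; rw [if_neg h] at h2; omega
      have := card1 4 e e' hl h3 h4; omega), ← hNA, ← hNB, hW, phi]
    have e1 : (N1 + 6 * N2 + 36 * NA + 252 * NB) % 6 = N1 := by omega
    have e2 : (N1 + 6 * N2 + 36 * NA + 252 * NB) / 6 % 6 = N2 := by omega
    have e3 : (N1 + 6 * N2 + 36 * NA + 252 * NB) / 36 % 7 = NA := by omega
    have e4 : (N1 + 6 * N2 + 36 * NA + 252 * NB) / 252 = NB := by omega
    rw [e1, e2, e3, e4]
    have e5 : (if NB = 0 then 0 else 1) = nP := by split_ifs <;> omega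
    rw [e5]
  · have hd : δ ^ nP = 0 := by
      obtain ⟨t, ht⟩ := Nat.exists_eq_add_of_le (show 2 ≤ nP by omega)
      rw [ht, pow_add, pow_two, hδ, zero_mul]
    have hnf : ¬ fok x := by
      intro h
      have : nP ≤ 1 := by
        by_contra _
        have hex : ∃ e, (x e).f = 1 := by
          by_contra hn
          push Not at hn
          have : nP = 0 := by rw [hnP]; exact Finset.sum_eq_zero fun e _ => if_neg (hn e)
          omega
        obtain ⟨e0, he0⟩ := hex
        have : nP = 1 := by
          rw [hnP, Finset.sum_eq_single e0, if_pos he0]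
          · intro e _ hne
            rw [if_neg]
            intro he
            rcases lt_or_gt_of_ne hne with h1 | h1
            · have := h e0 e h1; rw [he, he0] at this; exact absurd this (by decide)
            · have := h e e0 h1; rw [he, he0] at this; exact absurd this (by decide)
          · simp
        omega
      exact hP this
    rw [hd, if_neg hnf]; simp

/-- Vanishing on the normal form. -/
lemma II_normal (hδ : δ * δ = 0) (hq : qv 0 = 1) (hr : rv 0 = 1) :
    II (tenOf (ents fam) (fun q => xval k1 k2 δ qv rv (ents fam q))) = 0 := by
  classical
  have hf : ∀ q, okF (ents fam q).f := fun q => (fam_facts _ (List.get_mem _ _)).1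
  have h0 := run_sum0 96 fam hf
  have h3 := run_sum3 96 fam hf
  have hc := val_ok (fun _ => 1) _ big_check
  rw [val_merge, val_scale, val_scale, h0, h3] at hc
  rw [II, DD_expand, DD_expand]
  simp only [term_eq k1 k2 δ qv rv hδ hq hr reg_a0 reg_b0 reg_c0,
    term_eq k1 k2 δ qv rv hδ hq hr reg_a3 reg_b3 reg_c3]
  have key := packing (R := R) (2 ^ 96) (fun l : Fin 20 → Fin (entL fam).length =>
    (10 * sgn3 (vx la0) (vx lb0) (vx lc0) (ents fam) l -
      3 * sgn3 (vx la3) (vx lb3) (vx lc3) (ents fam) l) *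
        (if fok (fun e => ents fam (l e)) then 1 else 0)) (fun l => ∑ e, (ents fam (l e)).w) (by
      have : ∀ l : Fin 20 → Fin (entL fam).length,
          |(10 * sgn3 (vx la0) (vx lb0) (vx lc0) (ents fam) l -
      3 * sgn3 (vx la3) (vx lb3) (vx lc3) (ents fam) l) *
        (if fok (fun e => ents fam (l e)) then 1 else 0)| ≤ 13 := by
        intro l
        have hs : ∀ a b c, |sgn3 a b c (ents fam) l| ≤ 1 := by
          intro a b c
          rw [sgn3, abs_mul, abs_mul]
          exact mul_le_one₀ (mul_le_one₀ (sg_abs _ _) (abs_nonneg _) (sg_abs _ _)) (abs_nonneg _)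
            (sg_abs _ _)
        have s0 := abs_le.mp (hs (vx la0) (vx lb0) (vx lc0))
        have s3 := abs_le.mp (hs (vx la3) (vx lb3) (vx lc3))
        split_ifs
        · rw [mul_one, abs_le]; constructor <;> linarith [s0.1, s0.2, s3.1, s3.2]
        · simp
      refine lt_of_le_of_lt (Finset.sum_le_sum fun l _ => this l) ?_
      rw [Finset.sum_const, Finset.card_univ, Fintype.card_fun, Fintype.card_fin, Fintype.card_fin,
        fam_len]
      norm_num) (by
      refine Eq.trans ?_ hc
      rw [Finset.mul_sum, Finset.mul_sum, ← Finset.sum_add_distrib]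
      refine Finset.sum_congr rfl fun l _ => ?_
      push_cast; ring) (phi k1 k2 δ qv rv)
  refine Eq.trans ?_ key
  rw [Finset.mul_sum, Finset.mul_sum, ← Finset.sum_sub_distrib]
  refine Finset.sum_congr rfl fun l _ => ?_
  push_cast; ring

end


/-! ### The invariant as a polynomial; its differential -/

section
variable {R S : Type*} [CommRing R] [CommRing S]

lemma map_II (φ : R →+* S) (T : Ten R) : φ (II T) = II (fun i j k => φ (T i j k)) := by
  unfold II
  rw [map_sub, map_mul, map_mul, map_DD, map_DD, map_ofNat, map_ofNat]

lemma II_actA (g : Matrix (Fin 4) (Fin 4) R) (T : Ten R) : II (actA g T) = g.det ^ 5 * II T := by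
  unfold II; rw [DD_actA reg_a0, DD_actA reg_a3]; ring
lemma II_actB (g : Matrix (Fin 4) (Fin 4) R) (T : Ten R) : II (actB g T) = g.det ^ 5 * II T := by
  unfold II; rw [DD_actB reg_b0, DD_actB reg_b3]; ring
lemma II_actC (g : Matrix (Fin 4) (Fin 4) R) (T : Ten R) : II (actC g T) = g.det ^ 5 * II T := by
  unfold II; rw [DD_actC reg_c0, DD_actC reg_c3]; ring

/-- Terms only depend on the values used by balanced assignments. -/
lemma II_congr (T T' : Ten R)
    (h : ∀ α β γ : Fin 20 → Fin 4, (∀ i, ∑ e, (if α e = i then 1 else 0) = 5) →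
      (∀ i, ∑ e, (if β e = i then 1 else 0) = 5) → (∀ i, ∑ e, (if γ e = i then 1 else 0) = 5) →
      ∏ e, T (α e) (β e) (γ e) = ∏ e, T' (α e) (β e) (γ e)) : II T = II T' := by
  have key : ∀ a b c, Reg a → Reg b → Reg c → DD a b c T = DD a b c T' := by
    intro a b c ha hb hc
    unfold DD
    refine Finset.sum_congr rfl fun α _ => Finset.sum_congr rfl fun β _ =>
      Finset.sum_congr rfl fun γ _ => ?_
    by_cases h1 : sg a α = 0
    · simp [h1]
    by_cases h2 : sg b β = 0
    · simp [h2]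
    by_cases h3 : sg c γ = 0
    · simp [h3]
    rw [h α β γ (sg_count ha α h1) (sg_count hb β h2) (sg_count hc γ h3)]
  unfold II
  rw [key _ _ _ reg_a0 reg_b0 reg_c0, key _ _ _ reg_a3 reg_b3 reg_c3]

end

abbrev Idx := Fin 4 × Fin 4 × Fin 4

/-- The polynomial. -/
def Ipoly : MvPolynomial Idx ℂ := II (fun i j k => MvPolynomial.X (i, j, k))

lemma aeval_Ipoly {S : Type*} [CommRing S] [Algebra ℂ S] (T : Ten S) :
    MvPolynomial.aeval (fun x : Idx => T x.1 x.2.1 x.2.2) Ipoly = II T := by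
  have := map_II (MvPolynomial.aeval (R := ℂ) (fun x : Idx => T x.1 x.2.1 x.2.2)).toRingHom
    (fun i j k => MvPolynomial.X (i, j, k))
  simpa [Ipoly] using this

lemma eval_Ipoly (T : Ten ℂ) :
    MvPolynomial.eval (fun x : Idx => T x.1 x.2.1 x.2.2) Ipoly = II T := by
  rw [← aeval_Ipoly T, MvPolynomial.aeval_eq_eval]

lemma Ipoly_homog : Ipoly.IsHomogeneous 20 := by
  have key : ∀ a b c, (DD a b c (fun i j k => MvPolynomial.X (i, j, k) :
      Ten (MvPolynomial Idx ℂ))).IsHomogeneous 20 := by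
    intro a b c
    unfold DD
    refine MvPolynomial.IsHomogeneous.sum _ _ _ fun α _ => MvPolynomial.IsHomogeneous.sum _ _ _
      fun β _ => MvPolynomial.IsHomogeneous.sum _ _ _ fun γ _ => ?_
    have h1 : (∏ e : Fin 20, MvPolynomial.X (α e, β e, γ e) :
        MvPolynomial Idx ℂ).IsHomogeneous (∑ e : Fin 20, 1) :=
      MvPolynomial.IsHomogeneous.prod _ _ _ fun e _ => MvPolynomial.isHomogeneous_X _ _
    have h2 := h1.C_mul ((sg a α * sg b β * sg c γ : ℤ) : ℂ)
    simpa using h2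
  have e : Ipoly = MvPolynomial.C 10 * DD (vx la0) (vx lb0) (vx lc0)
      (fun i j k => MvPolynomial.X (i, j, k)) - MvPolynomial.C 3 * DD (vx la3) (vx lb3) (vx lc3)
      (fun i j k => MvPolynomial.X (i, j, k)) := by
    rw [show (MvPolynomial.C 10 : MvPolynomial Idx ℂ) = 10 from map_ofNat _ 10,
      show (MvPolynomial.C 3 : MvPolynomial Idx ℂ) = 3 from map_ofNat _ 3]
    rfl
  rw [e]
  exact ((key _ _ _).C_mul 10).sub ((key _ _ _).C_mul 3)

open TrivSqZeroExt in
/-- The point `U + ε V`. -/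
def dpt (U V : Ten ℂ) : Ten (DualNumber ℂ) := fun i j k => inl (U i j k) + inr (V i j k)

/-- Differential of the invariant. -/
def dI (U V : Ten ℂ) : ℂ := (II (dpt U V)).snd

open TrivSqZeroExt in
lemma aeval_dual (p : MvPolynomial Idx ℂ) (u v : Idx → ℂ) :
    MvPolynomial.aeval (fun x => (inl (u x) + inr (v x) : DualNumber ℂ)) p =
      inl (MvPolynomial.eval u p) +
        inr (∑ x, v x * MvPolynomial.eval u (MvPolynomial.pderiv x p)) := by
  induction p using MvPolynomial.induction_on with
  | C a => simp [TrivSqZeroExt.algebraMap_eq_inl]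
  | add p q hp hq =>
    rw [map_add, hp, hq]
    ext <;> simp [mul_add, Finset.sum_add_distrib]
  | mul_X p n hp =>
    rw [map_mul, hp, MvPolynomial.aeval_X]
    ext
    · simp
    · simp [MvPolynomial.pderiv_X, Pi.single_apply, mul_add, Finset.sum_add_distrib,
        apply_ite]
      ring_nf
      rw [Finset.sum_mul, add_comm]
      congr 1
      exact Finset.sum_congr rfl fun x _ => by ring

lemma dI_eq (U V : Ten ℂ) : dI U V = ∑ x : Idx, V x.1 x.2.1 x.2.2 *
    MvPolynomial.eval (fun x : Idx => U x.1 x.2.1 x.2.2) (MvPolynomial.pderiv x Ipoly) := by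
  have := aeval_dual Ipoly (fun x : Idx => U x.1 x.2.1 x.2.2) (fun x : Idx => V x.1 x.2.1 x.2.2)
  have h2 := aeval_Ipoly (dpt U V)
  unfold dpt at h2
  rw [this] at h2
  unfold dI dpt
  rw [← h2]
  simp

lemma dI_fst (U V : Ten ℂ) : (II (dpt U V)).fst = II U := by
  have := aeval_dual Ipoly (fun x : Idx => U x.1 x.2.1 x.2.2) (fun x : Idx => V x.1 x.2.1 x.2.2)
  have h2 := aeval_Ipoly (dpt U V)
  unfold dpt at h2
  rw [this, eval_Ipoly] at h2
  unfold dpt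
  rw [← h2]
  simp

lemma dI_add (U V W : Ten ℂ) : dI U (V + W) = dI U V + dI U W := by
  simp only [dI_eq, Pi.add_apply, add_mul, Finset.sum_add_distrib]
lemma dI_smul (c : ℂ) (U V : Ten ℂ) : dI U (c • V) = c * dI U V := by
  simp only [dI_eq, Pi.smul_apply, smul_eq_mul, Finset.mul_sum, mul_assoc]
lemma dI_sub (U V W : Ten ℂ) : dI U (V - W) = dI U V - dI U W := by
  simp only [dI_eq, Pi.sub_apply, sub_mul, Finset.sum_sub_distrib]
lemma dI_sum {ι : Type*} (s : Finset ι) (U : Ten ℂ) (V : ι → Ten ℂ) :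
    dI U (∑ i ∈ s, V i) = ∑ i ∈ s, dI U (V i) := by
  simp only [dI_eq, Finset.sum_apply, Finset.sum_mul]
  rw [Finset.sum_comm]

open TrivSqZeroExt in
lemma snd_inl_mul (c : ℂ) (z : DualNumber ℂ) : (inl c * z).snd = c * z.snd := by simp

open TrivSqZeroExt in
lemma det_inl (g : Matrix (Fin 4) (Fin 4) ℂ) :
    (g.map (fun x => (inl x : DualNumber ℂ))).det = inl g.det := by
  have := RingHom.map_det (inlHom ℂ ℂ) g
  exact this.symm

open TrivSqZeroExt in
lemma dI_actA (g : Matrix (Fin 4) (Fin 4) ℂ) (U V : Ten ℂ) :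
    dI (actA g U) (actA g V) = g.det ^ 5 * dI U V := by
  have h : dpt (actA g U) (actA g V) = actA (g.map (fun x => (inl x : DualNumber ℂ))) (dpt U V) := by
    funext i j k
    ext <;> simp [dpt, actA, TrivSqZeroExt.fst_sum, TrivSqZeroExt.snd_sum]
  unfold dI
  rw [h, II_actA, det_inl, inl_pow, snd_inl_mul]
open TrivSqZeroExt in
lemma dI_actB (g : Matrix (Fin 4) (Fin 4) ℂ) (U V : Ten ℂ) :
    dI (actB g U) (actB g V) = g.det ^ 5 * dI U V := by
  have h : dpt (actB g U) (actB g V) = actB (g.map (fun x => (inl x : DualNumber ℂ))) (dpt U V) := by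
    funext i j k
    ext <;> simp [dpt, actB, TrivSqZeroExt.fst_sum, TrivSqZeroExt.snd_sum]
  unfold dI
  rw [h, II_actB, det_inl, inl_pow, snd_inl_mul]
open TrivSqZeroExt in
lemma dI_actC (g : Matrix (Fin 4) (Fin 4) ℂ) (U V : Ten ℂ) :
    dI (actC g U) (actC g V) = g.det ^ 5 * dI U V := by
  have h : dpt (actC g U) (actC g V) = actC (g.map (fun x => (inl x : DualNumber ℂ))) (dpt U V) := by
    funext i j k
    ext <;> simp [dpt, actC, TrivSqZeroExt.fst_sum, TrivSqZeroExt.snd_sum]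
  unfold dI
  rw [h, II_actC, det_inl, inl_pow, snd_inl_mul]

/-- The restriction of the invariant to a line. -/
def lineP (U V : Ten ℂ) : Polynomial ℂ :=
  II (fun i j k => Polynomial.C (U i j k) + Polynomial.X * Polynomial.C (V i j k))

lemma lineP_eval (U V : Ten ℂ) (s : ℂ) : (lineP U V).eval s = II (U + s • V) := by
  have := map_II (Polynomial.evalRingHom s)
    (fun i j k => Polynomial.C (U i j k) + Polynomial.X * Polynomial.C (V i j k))
  rw [lineP, ← Polynomial.coe_evalRingHom, this]
  congr 1
  funext i j k
  simp
  ring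

open TrivSqZeroExt in
lemma lineP_dual (U V : Ten ℂ) :
    Polynomial.aeval (DualNumber.eps : DualNumber ℂ) (lineP U V) = II (dpt U V) := by
  have := map_II (Polynomial.aeval (R := ℂ) (DualNumber.eps : DualNumber ℂ)).toRingHom
    (fun i j k => Polynomial.C (U i j k) + Polynomial.X * Polynomial.C (V i j k))
  refine Eq.trans this ?_
  congr 1
  funext i j k
  ext <;> simp [dpt, TrivSqZeroExt.algebraMap_eq_inl]

lemma dI_of_line (U V : Ten ℂ) (h : ∀ s : ℂ, II (U + s • V) = 0) : dI U V = 0 := by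
  have : lineP U V = 0 := Polynomial.funext fun s => by rw [lineP_eval, h]; simp
  unfold dI
  rw [← lineP_dual, this]
  simp


/-! ### Tensors whose zeroth slice is the unit matrix `e₀ ⊗ e₀` -/

abbrev Ten3 := Fin 3 → Fin 3 → Fin 3 → ℂ

def mkU (w : Fin 3 → ℂ) (Q R : Matrix (Fin 3) (Fin 3) ℂ) (K : Ten3) : Ten ℂ := fun i j k =>
  Fin.cases (Fin.cases (Fin.cases 1 (fun _ => 0) k) (fun _ => 0) j)
    (fun i => Fin.cases (Fin.cases (w i) (fun k => Q i k) k)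
      (fun j => Fin.cases (R i j) (fun k => K i j k) k) j) i

section
variable (w : Fin 3 → ℂ) (Q R : Matrix (Fin 3) (Fin 3) ℂ) (K : Ten3) (i j k : Fin 3)
@[simp] lemma mkU_000 : mkU w Q R K 0 0 0 = 1 := rfl
@[simp] lemma mkU_00k : mkU w Q R K 0 0 k.succ = 0 := rfl
@[simp] lemma mkU_0j (k : Fin 4) : mkU w Q R K 0 j.succ k = 0 := rfl
@[simp] lemma mkU_i00 : mkU w Q R K i.succ 0 0 = w i := rfl
@[simp] lemma mkU_i0k : mkU w Q R K i.succ 0 k.succ = Q i k := rfl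
@[simp] lemma mkU_ij0 : mkU w Q R K i.succ j.succ 0 = R i j := rfl
@[simp] lemma mkU_ijk : mkU w Q R K i.succ j.succ k.succ = K i j k := rfl
end

def mkV (S : Matrix (Fin 3) (Fin 3) ℂ) : Ten ℂ := fun i j k =>
  Fin.cases (Fin.cases 0 (fun j => Fin.cases 0 (fun k => S j k) k) j) (fun _ => 0) i

section
variable (S : Matrix (Fin 3) (Fin 3) ℂ) (j k : Fin 3)
@[simp] lemma mkV_00 (k : Fin 4) : mkV S 0 0 k = 0 := rfl
@[simp] lemma mkV_0j0 : mkV S 0 j.succ 0 = 0 := rfl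
@[simp] lemma mkV_0jk : mkV S 0 j.succ k.succ = S j k := rfl
@[simp] lemma mkV_i (i : Fin 3) (j k : Fin 4) : mkV S i.succ j k = 0 := rfl
end

lemma ten_ext {R : Type*} {T T' : Ten R} (h000 : T 0 0 0 = T' 0 0 0)
    (h00k : ∀ k : Fin 3, T 0 0 k.succ = T' 0 0 k.succ)
    (h0j0 : ∀ j : Fin 3, T 0 j.succ 0 = T' 0 j.succ 0)
    (h0jk : ∀ j k : Fin 3, T 0 j.succ k.succ = T' 0 j.succ k.succ)
    (hi00 : ∀ i : Fin 3, T i.succ 0 0 = T' i.succ 0 0)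
    (hi0k : ∀ i k : Fin 3, T i.succ 0 k.succ = T' i.succ 0 k.succ)
    (hij0 : ∀ i j : Fin 3, T i.succ j.succ 0 = T' i.succ j.succ 0)
    (hijk : ∀ i j k : Fin 3, T i.succ j.succ k.succ = T' i.succ j.succ k.succ) : T = T' := by
  funext i j k
  cases i using Fin.cases <;> cases j using Fin.cases <;> cases k using Fin.cases <;> simp_all

/-- Tensors with unit zeroth slice. -/
def IsU (U : Ten ℂ) : Prop :=
  U 0 0 0 = 1 ∧ (∀ k : Fin 3, U 0 0 k.succ = 0) ∧ ∀ (j : Fin 3) (k : Fin 4), U 0 j.succ k = 0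

lemma isU_mkU (w : Fin 3 → ℂ) (Q R : Matrix (Fin 3) (Fin 3) ℂ) (K : Ten3) : IsU (mkU w Q R K) := by
  refine ⟨?_, ?_, ?_⟩ <;> simp

lemma IsU.eq {U : Ten ℂ} (h : IsU U) : U = mkU (fun i => U i.succ 0 0)
    (Matrix.of fun i k => U i.succ 0 k.succ) (Matrix.of fun i j => U i.succ j.succ 0)
    (fun i j k => U i.succ j.succ k.succ) := by
  obtain ⟨h1, h2, h3⟩ := h
  apply ten_ext <;> intros <;> first | rfl | simp [h1, h2, h3]

/-- Block matrix with an isolated unit in the corner. -/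
def bl (X : Matrix (Fin 3) (Fin 3) ℂ) : Matrix (Fin 4) (Fin 4) ℂ := fun i j =>
  Fin.cases (Fin.cases 1 (fun _ => 0) j) (fun i => Fin.cases 0 (fun j => X i j) j) i

section
variable (X : Matrix (Fin 3) (Fin 3) ℂ) (i j : Fin 3)
@[simp] lemma bl_00 : bl X 0 0 = 1 := rfl
@[simp] lemma bl_0j : bl X 0 j.succ = 0 := rfl
@[simp] lemma bl_i0 : bl X i.succ 0 = 0 := rfl
@[simp] lemma bl_ij : bl X i.succ j.succ = X i j := rfl
end

lemma bl_det (X : Matrix (Fin 3) (Fin 3) ℂ) : (bl X).det = X.det := by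
  rw [Matrix.det_succ_row_zero, Fin.sum_univ_succ]
  simp
  congr 1

def aA (X : Matrix (Fin 3) (Fin 3) ℂ) (K : Ten3) : Ten3 := fun i j k => ∑ i', X i i' * K i' j k
def aB (X : Matrix (Fin 3) (Fin 3) ℂ) (K : Ten3) : Ten3 := fun i j k => ∑ j', X j j' * K i j' k
def aC (X : Matrix (Fin 3) (Fin 3) ℂ) (K : Ten3) : Ten3 := fun i j k => ∑ k', X k k' * K i j k'

section
variable (X : Matrix (Fin 3) (Fin 3) ℂ) (w : Fin 3 → ℂ) (Q R S : Matrix (Fin 3) (Fin 3) ℂ) (K : Ten3)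

lemma actA_mkU : actA (bl X) (mkU w Q R K) = mkU (X.mulVec w) (X * Q) (X * R) (aA X K) := by
  apply ten_ext <;> simp [actA, aA, Fin.sum_univ_succ, Matrix.mul_apply, Matrix.mulVec, dotProduct]
lemma actB_mkU : actB (bl X) (mkU w Q R K) = mkU w Q (R * X.transpose) (aB X K) := by
  apply ten_ext <;> simp [actB, aB, Fin.sum_univ_succ, Matrix.mul_apply, mul_comm]
lemma actC_mkU : actC (bl X) (mkU w Q R K) = mkU w (Q * X.transpose) R (aC X K) := by
  apply ten_ext <;> simp [actC, aC, Fin.sum_univ_succ, Matrix.mul_apply, mul_comm]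
lemma actA_mkV : actA (bl X) (mkV S) = mkV S := by
  apply ten_ext <;> simp [actA, Fin.sum_univ_succ]
lemma actB_mkV : actB (bl X) (mkV S) = mkV (X * S) := by
  apply ten_ext <;> simp [actB, Fin.sum_univ_succ, Matrix.mul_apply]
lemma actC_mkV : actC (bl X) (mkV S) = mkV (S * X.transpose) := by
  apply ten_ext <;> simp [actC, Fin.sum_univ_succ, Matrix.mul_apply, mul_comm]
end

lemma dI_infB (U : Ten ℂ) (h : II U = 0) (N : Matrix (Fin 4) (Fin 4) ℂ) : dI U (actB N U) = 0 := by
  apply dI_of_line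
  intro s
  have : U + s • actB N U = actB (1 + s • N) U := by
    funext i j k
    simp [actB, add_mul, Finset.sum_add_distrib, Matrix.one_apply, Finset.mul_sum, mul_assoc]
  rw [this, II_actB, h, mul_zero]
lemma dI_infC (U : Ten ℂ) (h : II U = 0) (N : Matrix (Fin 4) (Fin 4) ℂ) : dI U (actC N U) = 0 := by
  apply dI_of_line
  intro s
  have : U + s • actC N U = actC (1 + s • N) U := by
    funext i j k
    simp [actC, add_mul, Finset.sum_add_distrib, Matrix.one_apply, Finset.mul_sum, mul_assoc]
  rw [this, II_actC, h, mul_zero]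

/-- Reduction of tangent directions, given the vanishing of the invariant. -/
lemma dI_red (hI : ∀ U, IsU U → II U = 0) {U : Ten ℂ} (hU : IsU U) (V : Ten ℂ) :
    dI U V = dI U (mkV (Matrix.of fun j k => V 0 j.succ k.succ)) := by
  obtain ⟨h1, h2, h3⟩ := id hU
  set N : Matrix (Fin 4) (Fin 4) ℂ := fun k k' => if k' = 0 then V 0 0 k else 0 with hN
  set M : Matrix (Fin 4) (Fin 4) ℂ := fun j j' => if j' = 0 ∧ j ≠ 0 then V 0 j 0 else 0 with hM
  have e1 := dI_infC U (hI U hU) N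
  have e2 := dI_infB U (hI U hU) M
  set W := V - mkV (Matrix.of fun j k => V 0 j.succ k.succ) - actC N U - actB M U with hW
  have e3 : dI U W = 0 := by
    apply dI_of_line
    intro s
    apply hI
    have z : ∀ j k, W 0 j k = 0 := by
      intro j k
      cases j using Fin.cases <;> cases k using Fin.cases <;>
        simp [hW, hN, hM, actB, actC, h1, h2, h3]
    refine ⟨?_, ?_, ?_⟩ <;> simp [z, h1, h2, h3]
  have : V = mkV (Matrix.of fun j k => V 0 j.succ k.succ) + W + actC N U + actB M U := by
    rw [hW]; abel
  conv_lhs => rw [this]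
  rw [dI_add, dI_add, dI_add, e1, e2, e3]; ring

def PPS (S : Matrix (Fin 3) (Fin 3) ℂ) (K : Ten3) : Prop := ∀ w Q R, dI (mkU w Q R K) (mkV S) = 0

section
variable {X S : Matrix (Fin 3) (Fin 3) ℂ} {K : Ten3}

lemma PPS.A (hX : IsUnit X.det) (h : PPS S K) : PPS S (aA X K) := by
  intro w Q R
  have := dI_actA (bl X) (mkU (X⁻¹.mulVec w) (X⁻¹ * Q) (X⁻¹ * R) K) (mkV S)
  rw [h, mul_zero, actA_mkU, actA_mkV, Matrix.mul_nonsing_inv_cancel_left _ _ hX,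
    Matrix.mul_nonsing_inv_cancel_left _ _ hX, Matrix.mulVec_mulVec, Matrix.mul_nonsing_inv _ hX,
    Matrix.one_mulVec] at this
  exact this
lemma PPS.B (hX : IsUnit X.det) (h : PPS S K) : PPS (X * S) (aB X K) := by
  intro w Q R
  have := dI_actB (bl X) (mkU w Q (R * X.transpose⁻¹) K) (mkV S)
  rw [h, mul_zero, actB_mkU, actB_mkV, Matrix.nonsing_inv_mul_cancel_right _ _
    (by rwa [Matrix.det_transpose])] at this
  exact this
lemma PPS.C (hX : IsUnit X.det) (h : PPS S K) : PPS (S * X.transpose) (aC X K) := by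
  intro w Q R
  have := dI_actC (bl X) (mkU w (Q * X.transpose⁻¹) R K) (mkV S)
  rw [h, mul_zero, actC_mkU, actC_mkV, Matrix.nonsing_inv_mul_cancel_right _ _
    (by rwa [Matrix.det_transpose])] at this
  exact this
end


/-! ### The normal form -/

def hs (n : Fin 3 → Fin 3 → ℂ) : Ten3 := fun i j k => if i + j + k = 0 then n i j else 0

def nfn (k1 k2 : ℂ) : Fin 3 → Fin 3 → ℂ := ![![1, 1, 1], ![k1, 1, 1], ![k2, 1, 1]]

def six (q : ℕ → ℂ) : Matrix (Fin 3) (Fin 3) ℂ := !![q 1, 0, q 2; q 3, q 4, 0; 0, q 5, q 6]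

def E22 : Matrix (Fin 3) (Fin 3) ℂ := !![0, 0, 0; 0, 0, 0; 0, 0, 1]

lemma tenOf_list {R : Type*} [CommRing R] (E : Fin 4 → ET) (φ : Ent → R) (i j k : Fin 4) :
    tenOf (ents E) (fun q => φ (ents E q)) i j k =
      ((entL E).map fun x => if i = x.i ∧ j = x.j ∧ k = x.k then φ x else 0).sum := by
  unfold tenOf ents
  rw [← Fin.sum_univ_fun_getElem]
  rfl

lemma fc1 {α : Type*} (a : α) (f : Fin 3 → α) :
    (Fin.cases a f (1 : Fin 4) : α) = f 0 := rfl
lemma fc2 {α : Type*} (a : α) (f : Fin 3 → α) :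
    (Fin.cases a f (2 : Fin 4) : α) = f 1 := rfl
lemma fc3 {α : Type*} (a : α) (f : Fin 3 → α) :
    (Fin.cases a f (3 : Fin 4) : α) = f 2 := rfl

open TrivSqZeroExt in
lemma nf_ten (k1 k2 : ℂ) (q r : ℕ → ℂ) (hq : q 0 = 1) (hr : r 0 = 1) :
    tenOf (ents fam) (fun p => xval (inl k1) (inl k2) (inr 1 : DualNumber ℂ)
      (fun m => inl (q m)) (fun m => inl (r m)) (ents fam p)) =
      dpt (mkU 0 (six q) (six r) (hs (nfn k1 k2))) (mkV E22) := by
  funext i j k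
  rw [tenOf_list]
  simp only [entL_fam, fam0, fam1, fam2, fam3, ET.toL, List.cons_append, List.nil_append,
    List.map_cons, List.map_nil, List.sum_cons, List.sum_nil, xval, add_zero]
  fin_cases i <;> fin_cases j <;> fin_cases k <;>
    simp [-DualNumber.inr_eq_smul_eps, dpt, mkU, mkV, hq, hr, six, hs, nfn, E22, fc1, fc2, fc3]


open TrivSqZeroExt in
lemma nf_dpt (k1 k2 : ℂ) (q r : ℕ → ℂ) (hq : q 0 = 1) (hr : r 0 = 1) :
    II (dpt (mkU 0 (six q) (six r) (hs (nfn k1 k2))) (mkV E22)) = 0 := by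
  rw [← nf_ten k1 k2 q r hq hr]
  apply II_normal
  · simp [-DualNumber.inr_eq_smul_eps]
  · simp [hq]
  · simp [hr]

lemma nf_dI (k1 k2 : ℂ) (q r : ℕ → ℂ) (hq : q 0 = 1) (hr : r 0 = 1) :
    dI (mkU 0 (six q) (six r) (hs (nfn k1 k2))) (mkV E22) = 0 := by
  rw [dI, nf_dpt k1 k2 q r hq hr]; rfl

/-- Vanishing of the invariant on the core. -/
def P1 (K : Ten3) : Prop := II (mkU 0 0 0 K) = 0

lemma nf_P1 (k1 k2 : ℂ) : P1 (hs (nfn k1 k2)) := by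
  have := dI_fst (mkU 0 (six fun m => if m = 0 then 1 else 0) (six fun m => if m = 0 then 1 else 0)
    (hs (nfn k1 k2))) (mkV E22)
  rw [nf_dpt k1 k2 _ _ (by simp) (by simp)] at this
  have e : (six fun m => if m = 0 then 1 else 0) = 0 := by
    ext i j; fin_cases i <;> fin_cases j <;> simp [six]
  rw [e] at this
  exact this.symm

lemma P1.A {X : Matrix (Fin 3) (Fin 3) ℂ} {K : Ten3} (h : P1 K) : P1 (aA X K) := by
  have := II_actA (bl X) (mkU 0 0 0 K)
  rw [h, mul_zero, actA_mkU] at this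
  simpa [P1] using this
lemma P1.B {X : Matrix (Fin 3) (Fin 3) ℂ} {K : Ten3} (h : P1 K) : P1 (aB X K) := by
  have := II_actB (bl X) (mkU 0 0 0 K)
  rw [h, mul_zero, actB_mkU] at this
  simpa [P1] using this
lemma P1.C {X : Matrix (Fin 3) (Fin 3) ℂ} {K : Ten3} (h : P1 K) : P1 (aC X K) := by
  have := II_actC (bl X) (mkU 0 0 0 K)
  rw [h, mul_zero, actC_mkU] at this
  simpa [P1] using this

lemma diag_act (a b c : Fin 3 → ℂ) (K : Ten3) :
    aA (Matrix.diagonal a) (aB (Matrix.diagonal b) (aC (Matrix.diagonal c) K)) =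
      fun i j k => a i * b j * c k * K i j k := by
  funext i j k
  simp [aA, aB, aC, Matrix.diagonal_apply]
  ring

lemma torus (n : Fin 3 → Fin 3 → ℂ) (hn : ∀ i j, n i j ≠ 0) :
    ∃ (a b c : Fin 3 → ℂ) (k1 k2 : ℂ), (∀ i, a i ≠ 0) ∧ (∀ i, b i ≠ 0) ∧ (∀ i, c i ≠ 0) ∧
      k1 ≠ 0 ∧ k2 ≠ 0 ∧ hs n = aA (Matrix.diagonal a) (aB (Matrix.diagonal b)
        (aC (Matrix.diagonal c) (hs (nfn k1 k2)))) := by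
  have h00 := hn 0 0
  have h01 := hn 0 1
  have h02 := hn 0 2
  have h11 := hn 1 1
  have h12 := hn 1 2
  have h21 := hn 2 1
  have h22 := hn 2 2
  obtain ⟨z, hz⟩ := IsAlgClosed.exists_pow_nat_eq
    (n 2 2 * n 0 2 * n 1 2 / (n 0 1 * n 1 1 * n 2 1)) (n := 3) (by norm_num)
  have hz0 : z ≠ 0 := by
    rintro rfl
    have : n 2 2 * n 0 2 * n 1 2 / (n 0 1 * n 1 1 * n 2 1) ≠ 0 := by positivity
    exact this (by rw [← hz]; simp)
  have hz' : z ^ 3 * (n 0 1 * n 1 1 * n 2 1) = n 2 2 * n 0 2 * n 1 2 := by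
    rw [hz]; field_simp
  obtain ⟨a1, ha1⟩ : ∃ x, x = z * n 1 1 / n 0 2 := ⟨_, rfl⟩
  obtain ⟨a2, ha2⟩ : ∃ x, x = z ^ 2 * n 1 1 * n 2 1 / (n 0 2 * n 1 2) := ⟨_, rfl⟩
  have ha10 : a1 ≠ 0 := by rw [ha1]; positivity
  have ha20 : a2 ≠ 0 := by rw [ha2]; positivity
  obtain ⟨c0, hc0⟩ : ∃ x, x = n 2 1 / a2 := ⟨_, rfl⟩
  have hc00 : c0 ≠ 0 := by rw [hc0]; positivity
  obtain ⟨c1, hc1⟩ : ∃ x, x = n 1 1 / a1 := ⟨_, rfl⟩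
  have hc10 : c1 ≠ 0 := by rw [hc1]; positivity
  obtain ⟨b0, hb0⟩ : ∃ x, x = n 0 0 / c0 := ⟨_, rfl⟩
  have hb00 : b0 ≠ 0 := by rw [hb0]; positivity
  refine ⟨![1, a1, a2], ![b0, 1, z], ![c0, c1, n 0 1], n 1 0 / (a1 * b0 * n 0 1),
    n 2 0 / (a2 * b0 * c1), ?_, ?_, ?_, ?_, ?_, ?_⟩
  · intro i; fin_cases i <;> simp [ha10, ha20]
  · intro i; fin_cases i <;> simp [hz0, hb00]
  · intro i; fin_cases i <;> simp [hc00, hc10, h01]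
  · have := hn 1 0
    positivity
  · have := hn 2 0
    positivity
  · rw [diag_act]
    have e00 : n 0 0 = b0 * c0 := by rw [hb0]; field_simp
    have e02 : n 0 2 = z * c1 := by rw [hc1, ha1]; field_simp
    have e10 : n 1 0 = a1 * b0 * n 0 1 * (n 1 0 / (a1 * b0 * n 0 1)) := by field_simp
    have e11 : n 1 1 = a1 * c1 := by rw [hc1]; field_simp
    have e12 : n 1 2 = a1 * z * c0 := by rw [hc0, ha2, ha1]; field_simp
    have e20 : n 2 0 = a2 * b0 * c1 * (n 2 0 / (a2 * b0 * c1)) := by field_simp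
    have e21 : n 2 1 = a2 * c0 := by rw [hc0]; field_simp
    have e22 : n 2 2 = a2 * z * n 0 1 := by
      rw [ha2]; field_simp; linear_combination -hz'
    funext i j k
    fin_cases i <;> fin_cases j <;> fin_cases k <;> simp [hs, nfn] <;> assumption

lemma P1_hs (n : Fin 3 → Fin 3 → ℂ) (hn : ∀ i j, n i j ≠ 0) : P1 (hs n) := by
  obtain ⟨a, b, c, k1, k2, _, _, _, _, _, h⟩ := torus n hn
  rw [h]
  exact (nf_P1 k1 k2).C.B.A


/-! ### Density of the orbits of Hesse tensors -/

/-- Columns of six times the inverse of the two tangent systems. -/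
def tanTab (s : Fin 3) : List (List ℤ) :=
  if s = 1 then
  [[-2, 1, 0, -2, -1, 0, 0, 1, -2],
   [-2, 1, 0, 0, 1, 2, 2, -1, 0],
   [2, 2, 0, -2, 0, 2, 2, 0, -2],
   [0, 1, 2, 2, 1, 0, -2, 1, 0],
   [0, 2, -2, 0, -2, 2, 4, 0, 2],
   [0, -2, 2, 4, 0, 2, 0, 2, 2],
   [-2, 0, -2, 2, -2, 0, 2, 0, -2],
   [-4, 0, 2, 0, -2, 2, 0, -2, -2],
   [2, 0, 2, 2, 0, -2, 2, 2, 0]]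
  else
  [[-2, 0, 1, 2, 0, 1, 0, 2, 1],
   [2, 0, 2, 2, -2, 0, 2, 2, 0],
   [2, 0, -1, 0, 2, 1, -2, 0, 1],
   [2, -2, 0, 2, 0, -2, -2, -2, 0],
   [2, -2, 0, -2, 2, 0, 2, 0, 2],
   [4, 2, 0, 0, 2, -2, 0, -2, 2],
   [0, -2, 1, -2, 0, -1, -2, 0, 1],
   [0, 2, 2, 4, 2, 0, 0, 2, -2],
   [0, -2, -2, 0, 2, -2, -4, 2, 0]]

def n0 : Fin 3 → Fin 3 → ℤ := ![![2, 1, -1], ![-1, 1, 1], ![-1, -1, 1]]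

def tanE (a b c : Fin 3) (u : ℕ) : ℤ :=
  ((tanTab (a + b + c)).getD (3 * a.val + b.val) []).getD u 0

def tanV (a b c : Fin 3) : Fin 4 → Fin 3 → Fin 3 → ℤ := fun l i i' =>
  if a + b + c = 0 then (if l = 3 ∧ i = a ∧ i' = b then 6 else 0)
  else if l = 3 then 0 else if i' = i - (a + b + c) then tanE a b c (3 * l.val + i.val) else 0

def PhiR {R : Type*} [CommRing R] (p : Fin 4 → Fin 3 → Fin 3 → R) (i j k : Fin 3) : R :=
  ∑ i', ∑ j', ∑ k', p 0 i i' * (p 1 j j' * (p 2 k k' * (if i' + j' + k' = 0 then p 3 i' j' else 0)))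

def dPhiR {R : Type*} [CommRing R] (p v : Fin 4 → Fin 3 → Fin 3 → R) (i j k : Fin 3) : R :=
  ∑ i', ∑ j', ∑ k',
    (v 0 i i' * (p 1 j j' * (p 2 k k' * (if i' + j' + k' = 0 then p 3 i' j' else 0)))
    + p 0 i i' * (v 1 j j' * (p 2 k k' * (if i' + j' + k' = 0 then p 3 i' j' else 0))
    + p 1 j j' * (v 2 k k' * (if i' + j' + k' = 0 then p 3 i' j' else 0)
    + p 2 k k' * (if i' + j' + k' = 0 then v 3 i' j' else 0))))

def p0R (R : Type*) [CommRing R] : Fin 4 → Fin 3 → Fin 3 → R := fun l i j =>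
  if l = 3 then (n0 i j : R) else if i = j then 1 else 0

lemma tan_check : ∀ a b c i j k : Fin 3, dPhiR (p0R ℤ) (tanV a b c) i j k =
    if a = i ∧ b = j ∧ c = k then 6 else 0 := by
  decide +kernel

lemma tan_checkC (a b c i j k : Fin 3) :
    dPhiR (p0R ℂ) (fun l i j => (tanV a b c l i j : ℂ)) i j k =
    if a = i ∧ b = j ∧ c = k then 6 else 0 := by
  have h := congrArg (fun z : ℤ => (z : ℂ)) (tan_check a b c i j k)
  simp only [dPhiR, p0R] at h ⊢
  push_cast at h
  exact h

lemma phi_eq (p : Fin 4 → Fin 3 → Fin 3 → ℂ) :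
    PhiR p = aA (Matrix.of (p 0)) (aB (Matrix.of (p 1)) (aC (Matrix.of (p 2)) (hs (p 3)))) := by
  funext i j k
  simp only [PhiR, aA, aB, aC, hs, Finset.mul_sum, Matrix.of_apply]

lemma hasDeriv4 (a b c d a' b' c' d' : ℂ) :
    HasDerivAt (fun t : ℂ => (a + t * a') * ((b + t * b') * ((c + t * c') * (d + t * d'))))
      (a' * (b * (c * d)) + a * (b' * (c * d) + b * (c' * d + c * d'))) 0 := by
  have l : ∀ x x' : ℂ, HasDerivAt (fun t : ℂ => x + t * x') x' 0 := by
    intro x x'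
    simpa using ((hasDerivAt_id (0 : ℂ)).mul_const x').const_add x
  have := (l a a').fun_mul ((l b b').fun_mul ((l c c').fun_mul (l d d')))
  simpa only [zero_mul, add_zero] using this

lemma phi_line (p v : Fin 4 → Fin 3 → Fin 3 → ℂ) :
    HasDerivAt (fun t : ℂ => PhiR (p + t • v)) (dPhiR p v) 0 := by
  rw [hasDerivAt_pi]; intro i
  rw [hasDerivAt_pi]; intro j
  rw [hasDerivAt_pi]; intro k
  unfold PhiR dPhiR
  refine HasDerivAt.fun_sum fun i' _ => HasDerivAt.fun_sum fun j' _ => HasDerivAt.fun_sum fun k' _ => ?_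
  split_ifs with h
  · exact hasDeriv4 _ _ _ _ _ _ _ _
  · simpa using hasDerivAt_const (0 : ℂ) (0 : ℂ)

lemma phi_contDiff : ContDiff ℂ 1 (PhiR : (Fin 4 → Fin 3 → Fin 3 → ℂ) → Fin 3 → Fin 3 → Fin 3 → ℂ) := by
  rw [contDiff_pi]; intro i
  rw [contDiff_pi]; intro j
  rw [contDiff_pi]; intro k
  unfold PhiR
  refine ContDiff.sum fun i' _ => ContDiff.sum fun j' _ => ContDiff.sum fun k' _ => ?_
  split_ifs with h
  · fun_prop
  · simpa using contDiff_const

lemma phi_surj : Function.Surjective (fderiv ℂ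
    (PhiR : (Fin 4 → Fin 3 → Fin 3 → ℂ) → Fin 3 → Fin 3 → Fin 3 → ℂ) (p0R ℂ)) := by
  set D := fderiv ℂ
    (PhiR : (Fin 4 → Fin 3 → Fin 3 → ℂ) → Fin 3 → Fin 3 → Fin 3 → ℂ) (p0R ℂ) with hD
  have hv : ∀ v, D v = dPhiR (p0R ℂ) v := by
    intro v
    have h1 : HasFDerivAt (PhiR : (Fin 4 → Fin 3 → Fin 3 → ℂ) → Fin 3 → Fin 3 → Fin 3 → ℂ) D
        (p0R ℂ) := (phi_contDiff.differentiable (by norm_num) _).hasFDerivAt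
    have h2 : HasDerivAt (fun t : ℂ => p0R ℂ + t • v) v 0 := by
      simpa using ((hasDerivAt_id (0 : ℂ)).smul_const v).const_add (p0R ℂ)
    have h3 := HasFDerivAt.comp_hasDerivAt (x := (0 : ℂ)) (l := PhiR) (l' := D)
      (f := fun t : ℂ => p0R ℂ + t • v) (by simpa using h1) h2
    exact h3.unique (phi_line _ _)
  intro K
  refine ⟨∑ a, ∑ b, ∑ c, (K a b c / 6) • (fun l i j => (tanV a b c l i j : ℂ)), ?_⟩
  simp only [map_sum, map_smul]
  simp only [hv]
  funext i j k
  simp only [Finset.sum_apply, Pi.smul_apply, tan_checkC, smul_eq_mul]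
  simp only [ite_and, mul_ite, mul_zero, Finset.sum_ite_eq', Finset.mem_univ, if_true]
  rw [Finset.sum_eq_single i, Finset.sum_eq_single j, Finset.sum_eq_single k]
  · simp
  all_goals simp +contextual

lemma density (G : Ten3 → ℂ)
    (hpoly : ∀ K0 K1, ∃ q : Polynomial ℂ, ∀ s : ℂ, q.eval s = G (K0 + s • K1))
    (h : ∀ (X Y Z : Matrix (Fin 3) (Fin 3) ℂ) n, IsUnit X.det → IsUnit Y.det → IsUnit Z.det →
      (∀ i j, n i j ≠ 0) → G (aA X (aB Y (aC Z (hs n)))) = 0) (K : Ten3) : G K = 0 := by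
  have hmap := HasStrictFDerivAt.map_nhds_eq_of_surj
    ((phi_contDiff.contDiffAt (x := p0R ℂ)).hasStrictFDerivAt (by norm_num))
    (LinearMap.range_eq_top.mpr phi_surj)
  have hA : ∀ᶠ p in nhds (p0R ℂ), G (PhiR p) = 0 := by
    have hd : ∀ l : Fin 4, l ≠ 3 → ∀ᶠ p in nhds (p0R ℂ), (Matrix.of (p l)).det ≠ 0 := by
      intro l hl
      have hc : Continuous fun p : Fin 4 → Fin 3 → Fin 3 → ℂ => (Matrix.of (p l)).det := by
        apply Continuous.matrix_det
        exact continuous_apply l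
      refine hc.continuousAt.eventually_ne ?_
      have : Matrix.of (p0R ℂ l) = 1 := by
        ext i j; simp [p0R, hl, Matrix.one_apply]
      rw [this]; simp
    have hn : ∀ᶠ p in nhds (p0R ℂ), ∀ i j, p 3 i j ≠ 0 := by
      rw [Filter.eventually_all]; intro i
      rw [Filter.eventually_all]; intro j
      have hc : Continuous fun p : Fin 4 → Fin 3 → Fin 3 → ℂ => p 3 i j := by fun_prop
      refine hc.continuousAt.eventually_ne ?_
      fin_cases i <;> fin_cases j <;> simp [p0R, n0]
    filter_upwards [hd 0 (by decide), hd 1 (by decide), hd 2 (by decide), hn] with p h0 h1 h2 h3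
    rw [phi_eq]
    exact h _ _ _ _ (isUnit_iff_ne_zero.mpr h0) (isUnit_iff_ne_zero.mpr h1)
      (isUnit_iff_ne_zero.mpr h2) h3
  have hB : ∀ᶠ K in nhds (PhiR (p0R ℂ)), G K = 0 := by
    rw [← hmap]; exact hA
  obtain ⟨q, hq⟩ := hpoly (PhiR (p0R ℂ)) (K - PhiR (p0R ℂ))
  have ht : Filter.Tendsto (fun s : ℂ => PhiR (p0R ℂ) + s • (K - PhiR (p0R ℂ))) (nhds 0)
      (nhds (PhiR (p0R ℂ))) := by
    have : Continuous (fun s : ℂ => PhiR (p0R ℂ) + s • (K - PhiR (p0R ℂ))) := by fun_prop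
    simpa using this.tendsto 0
  have hq0 : q = 0 := by
    apply Polynomial.eq_zero_of_infinite_isRoot
    refine infinite_of_mem_nhds (0 : ℂ) ?_
    filter_upwards [ht.eventually hB] with s hs0
    show q.IsRoot s
    rw [Polynomial.IsRoot, hq, hs0]
  have := hq 1
  rw [hq0] at this
  simpa using this.symm


/-! ### Vanishing of the invariant to second order -/

lemma line_poly (p : MvPolynomial Idx ℂ) (u v : Idx → ℂ) :
    ∃ q : Polynomial ℂ, ∀ s : ℂ, q.eval s = MvPolynomial.eval (u + s • v) p := by
  refine ⟨MvPolynomial.aeval (fun x => Polynomial.C (u x) + Polynomial.C (v x) * Polynomial.X) p, ?_⟩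
  intro s
  induction p using MvPolynomial.induction_on with
  | C a => simp
  | add p q hp hq => simp [hp, hq]
  | mul_X p n hp => simp [hp, mul_comm s]

lemma mkU_line (w : Fin 3 → ℂ) (Q R : Matrix (Fin 3) (Fin 3) ℂ) (K0 K1 : Ten3) (s : ℂ) :
    mkU w Q R (K0 + s • K1) = mkU w Q R K0 + s • (mkU 0 0 0 K1 - mkU 0 0 0 0) := by
  apply ten_ext <;> simp

lemma P1_all (K : Ten3) : P1 K := by
  refine density (fun K => II (mkU 0 0 0 K)) ?_ ?_ K
  · intro K0 K1
    refine ⟨lineP (mkU 0 0 0 K0) (mkU 0 0 0 K1 - mkU 0 0 0 0), fun s => ?_⟩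
    rw [lineP_eval, mkU_line]
  · intro X Y Z n _ _ _ hn
    exact (P1_hs n hn).C.B.A

lemma II_cont : Continuous (fun T : Ten ℂ => II T) := by
  have : (fun T : Ten ℂ => II T) = fun T : Ten ℂ =>
      MvPolynomial.eval (fun x : Idx => T x.1 x.2.1 x.2.2) Ipoly := by
    funext T; rw [eval_Ipoly]
  rw [this]
  exact (MvPolynomial.continuous_eval Ipoly).comp (by fun_prop)

lemma II_IsU (U : Ten ℂ) (hU : IsU U) : II U = 0 := by
  rw [hU.eq]
  generalize (fun i : Fin 3 => U i.succ 0 0) = w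
  generalize (Matrix.of fun i k : Fin 3 => U i.succ 0 k.succ) = Q
  generalize (Matrix.of fun i j : Fin 3 => U i.succ j.succ 0) = R
  generalize (fun i j k : Fin 3 => U i.succ j.succ k.succ) = K
  have hc : Continuous fun t : ℂ => II (mkU (t ^ 2 • w) (t • Q) (t • R) K) := by
    apply II_cont.comp
    refine continuous_pi fun i => continuous_pi fun j => continuous_pi fun k => ?_
    cases i using Fin.cases <;> cases j using Fin.cases <;> cases k using Fin.cases <;>
      simp <;> fun_prop
  have h1 : ∀ t : ℂ, t ≠ 0 → II (mkU (t ^ 2 • w) (t • Q) (t • R) K) = II (mkU w Q R K) := by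
    intro t ht
    have e : mkU (t ^ 2 • w) (t • Q) (t • R) K = actA (bl (t ^ 2 • 1)) (actB (bl (t⁻¹ • 1))
        (actC (bl (t⁻¹ • 1)) (mkU w Q R K))) := by
      rw [actC_mkU, actB_mkU, actA_mkU]
      congr 1
      · rw [Matrix.smul_mulVec, Matrix.one_mulVec]
      · simp [smul_smul]; congr 1; field_simp
      · simp [smul_smul]; congr 1; field_simp
      · funext i j k
        simp [aA, aB, aC, Matrix.one_apply]
        field_simp
    rw [e, II_actA, II_actB, II_actC, bl_det, bl_det, Matrix.det_smul, Matrix.det_smul]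
    simp
    field_simp
  have h2 : ∀ t : ℂ, II (mkU (t ^ 2 • w) (t • Q) (t • R) K) = II (mkU w Q R K) := by
    have := Continuous.ext_on (dense_compl_singleton (0 : ℂ)) hc continuous_const
      (g := fun _ => II (mkU w Q R K)) (fun t ht => h1 t ht)
    exact fun t => congrFun this t
  rw [← h2 0]
  have := P1_all K
  simpa [P1] using this

/-- Unipotent matrices. -/
def ug (b : Fin 3 → ℂ) : Matrix (Fin 4) (Fin 4) ℂ := fun i j =>
  Fin.cases (Fin.cases 1 b j) (fun i => if j = i.succ then 1 else 0) i
section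
variable (b : Fin 3 → ℂ)
@[simp] lemma ug_00 : ug b 0 0 = 1 := rfl
@[simp] lemma ug_0j (j : Fin 3) : ug b 0 j.succ = b j := rfl
@[simp] lemma ug_ij (i : Fin 3) (j : Fin 4) : ug b i.succ j = if j = i.succ then 1 else 0 := rfl
end

lemma ug_det (b : Fin 3 → ℂ) : (ug b).det = 1 := by
  rw [Matrix.det_of_isUpperTriangular]
  · rw [Fin.prod_univ_succ]; simp
  · intro i j hij
    cases i using Fin.cases with
    | zero => exact absurd hij (by simp)
    | succ i => simp only [id] at hij; rw [ug_ij, if_neg (ne_of_lt hij)]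

section
variable (w b : Fin 3 → ℂ) (Q R S : Matrix (Fin 3) (Fin 3) ℂ) (K : Ten3)

lemma stepB : dI (mkU w Q R K) (mkV S) = dI (mkU (w + R.mulVec b)
    (Q + Matrix.of fun i k => ∑ j, b j * K i j k) R K) (mkV S) := by
  have h := dI_actB (ug b) (mkU w Q R K) (mkV S)
  have e : actB (ug b) (mkU w Q R K) = mkU (w + R.mulVec b)
    (Q + Matrix.of fun i k => ∑ j, b j * K i j k) R K := by
    apply ten_ext <;> simp [actB, Fin.sum_univ_succ, Matrix.mulVec, dotProduct, mul_comm]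
  rw [ug_det, one_pow, one_mul, e, dI_red II_IsU (isU_mkU _ _ _ _)] at h
  rw [← h]
  congr 2
  ext j k
  simp [actB]

lemma stepC : dI (mkU w Q R K) (mkV S) = dI (mkU (w + Q.mulVec b) Q
    (R + Matrix.of fun i j => ∑ k, b k * K i j k) K) (mkV S) := by
  have h := dI_actC (ug b) (mkU w Q R K) (mkV S)
  have e : actC (ug b) (mkU w Q R K) = mkU (w + Q.mulVec b) Q
    (R + Matrix.of fun i j => ∑ k, b k * K i j k) K := by
    apply ten_ext <;> simp [actC, Fin.sum_univ_succ, Matrix.mulVec, dotProduct, mul_comm]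
  rw [ug_det, one_pow, one_mul, e, dI_red II_IsU (isU_mkU _ _ _ _)] at h
  rw [← h]
  congr 2
  ext j k
  simp [actC]

lemma stepA : dI (mkU w Q R K) (mkV S) = dI (mkU (w + b) Q R K) (mkV S) := by
  have h := dI_actA (ug b).transpose (mkU w Q R K) (mkV S)
  have e : actA (ug b).transpose (mkU w Q R K) = mkU (w + b) Q R K := by
    apply ten_ext <;> intros <;> simp [actA, Fin.sum_univ_succ, add_comm]
  rw [Matrix.det_transpose, ug_det, one_pow, one_mul, e, dI_red II_IsU (isU_mkU _ _ _ _)] at h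
  rw [← h]
  congr 2
  ext j k
  simp [actA, Fin.sum_univ_succ]
end

lemma six_of (Q : Matrix (Fin 3) (Fin 3) ℂ) (h1 : Q 0 1 = 0) (h2 : Q 1 2 = 0) (h3 : Q 2 0 = 0) :
    ∃ q : ℕ → ℂ, q 0 = 1 ∧ Q = six q := by
  refine ⟨fun m => [1, Q 0 0, Q 0 2, Q 1 0, Q 1 1, Q 2 1, Q 2 2].getD m 0, rfl, ?_⟩
  ext i j
  fin_cases i <;> fin_cases j <;> simp [six, h1, h2, h3]

lemma nf_PPS (k1 k2 : ℂ) (h1 : k1 ≠ 0) (h2 : k2 ≠ 0) : PPS E22 (hs (nfn k1 k2)) := by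
  intro w Q R
  rw [stepB w ![-Q 1 2 / k1, -Q 2 0, -Q 0 1], stepC _ ![-R 1 2, -R 2 0 / k2, -R 0 1]]
  generalize hQ : Q + _ = Q'
  generalize hR : R + _ = R'
  generalize w + _ + _ = w'
  rw [stepA w' (-w'), add_neg_cancel]
  obtain ⟨q, hq, rfl⟩ := six_of Q'
    (by rw [← hQ]; simp [Fin.sum_univ_succ, hs, nfn])
    (by rw [← hQ]; simp [Fin.sum_univ_succ, hs, nfn]; field_simp; simp)
    (by rw [← hQ]; simp [Fin.sum_univ_succ, hs, nfn])
  obtain ⟨r, hr, rfl⟩ := six_of R'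
    (by rw [← hR]; simp [Fin.sum_univ_succ, hs, nfn])
    (by rw [← hR]; simp [Fin.sum_univ_succ, hs, nfn])
    (by rw [← hR]; simp [Fin.sum_univ_succ, hs, nfn]; field_simp; simp)
  exact nf_dI k1 k2 q r hq hr


lemma mkV_smul (c : ℂ) (S : Matrix (Fin 3) (Fin 3) ℂ) : mkV (c • S) = c • mkV S := by
  apply ten_ext <;> simp

lemma det_diag_unit (a : Fin 3 → ℂ) (h : ∀ i, a i ≠ 0) : IsUnit (Matrix.diagonal a).det := by
  rw [Matrix.det_diagonal, isUnit_iff_ne_zero]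
  exact Finset.prod_ne_zero_iff.mpr fun i _ => h i

lemma PPS_E22 (n : Fin 3 → Fin 3 → ℂ) (hn : ∀ i j, n i j ≠ 0) : PPS E22 (hs n) := by
  obtain ⟨a, b, c, k1, k2, ha, hb, hc, h1, h2, h⟩ := torus n hn
  have := (((nf_PPS k1 k2 h1 h2).C (det_diag_unit c hc)).B (det_diag_unit b hb)).A
    (det_diag_unit a ha)
  rw [← h] at this
  have e : Matrix.diagonal b * (E22 * (Matrix.diagonal c).transpose) = (b 2 * c 2) • E22 := by
    ext i j
    rw [Matrix.diagonal_transpose, Matrix.diagonal_mul, Matrix.mul_diagonal]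
    fin_cases i <;> fin_cases j <;> simp [E22]
  rw [e] at this
  intro w Q R
  have h3 := this w Q R
  rw [mkV_smul, dI_smul] at h3
  exact (mul_eq_zero.mp h3).resolve_left (mul_ne_zero (hb 2) (hc 2))

/-- Cyclic shifts. -/
def sh (a : Fin 3) : Matrix (Fin 3) (Fin 3) ℂ := Matrix.of fun i i' => if i' = i + a then 1 else 0

lemma sh_sum (a i : Fin 3) (f : Fin 3 → ℂ) : ∑ i', sh a i i' * f i' = f (i + a) := by
  simp [sh]

lemma sh_det (a : Fin 3) : IsUnit (sh a).det := by
  have : sh a * sh (-a) = 1 := by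
    ext i j
    rw [Matrix.mul_apply, sh_sum]
    simp [sh, Matrix.one_apply, eq_comm]
  have h := congrArg Matrix.det this
  rw [Matrix.det_mul, Matrix.det_one] at h
  exact IsUnit.of_mul_eq_one _ h

lemma fin3_id : ∀ a b c i j k : Fin 3, a + b + c = 0 →
    i + a + (j + b) + (k + c) = i + j + k := by decide +kernel

lemma fin3_id2 : ∀ j k : Fin 3, -(2 - j) - (2 - k) + (2 - j) + (2 - k) = 0 := by decide

lemma sh_act (n : Fin 3 → Fin 3 → ℂ) (a b c : Fin 3) (h : a + b + c = 0) :
    aA (sh a) (aB (sh b) (aC (sh c) (hs fun i j => n (i - a) (j - b)))) = hs n := by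
  funext i j k
  simp only [aA, aB, aC, sh_sum, hs, fin3_id a b c i j k h, add_sub_cancel_right]

lemma PPS_single (n : Fin 3 → Fin 3 → ℂ) (hn : ∀ i j, n i j ≠ 0) (j k : Fin 3) :
    PPS (Matrix.single j k 1) (hs n) := by
  have h := (((PPS_E22 (fun i' j' => n (i' - (-(2 - j) - (2 - k))) (j' - (2 - j)))
    (fun _ _ => hn _ _)).C (sh_det (2 - k))).B (sh_det (2 - j))).A (sh_det (-(2 - j) - (2 - k)))
  rw [sh_act _ _ _ _ (fin3_id2 j k)] at h
  have e : sh (2 - j) * (E22 * (sh (2 - k)).transpose) = Matrix.single j k 1 := by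
    ext j' k'
    simp [sh, Matrix.mul_apply]
    fin_cases j <;> fin_cases k <;> fin_cases j' <;> fin_cases k' <;> simp [E22, Matrix.single]
  rwa [e] at h

lemma PPS_hs (n : Fin 3 → Fin 3 → ℂ) (hn : ∀ i j, n i j ≠ 0) (S : Matrix (Fin 3) (Fin 3) ℂ) :
    PPS S (hs n) := by
  intro w Q R
  have : mkV S = ∑ j, ∑ k, S j k • mkV (Matrix.single j k 1) := by
    apply ten_ext <;> intros <;> simp [Finset.sum_apply, Matrix.single, ite_and]
  rw [this, dI_sum]
  refine Finset.sum_eq_zero fun j _ => ?_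
  rw [dI_sum]
  refine Finset.sum_eq_zero fun k _ => ?_
  rw [dI_smul, PPS_single n hn j k w Q R, mul_zero]

lemma dI_line (U W V : Ten ℂ) : ∃ q : Polynomial ℂ, ∀ s : ℂ, q.eval s = dI (U + s • W) V := by
  choose q hq using fun x => line_poly (MvPolynomial.pderiv x Ipoly)
    (fun x : Idx => U x.1 x.2.1 x.2.2) (fun x : Idx => W x.1 x.2.1 x.2.2)
  refine ⟨∑ x : Idx, Polynomial.C (V x.1 x.2.1 x.2.2) * q x, fun s => ?_⟩
  rw [Polynomial.eval_finsetSum, dI_eq]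
  refine Finset.sum_congr rfl fun x _ => ?_
  rw [Polynomial.eval_mul, Polynomial.eval_C, hq]
  rfl

lemma PP_all (S : Matrix (Fin 3) (Fin 3) ℂ) (K : Ten3) : PPS S K := by
  intro w Q R
  refine density (fun K => dI (mkU w Q R K) (mkV S)) ?_ ?_ K
  · intro K0 K1
    obtain ⟨q, hq⟩ := dI_line (mkU w Q R K0) (mkU 0 0 0 K1 - mkU 0 0 0 0) (mkV S)
    refine ⟨q, fun s => ?_⟩
    rw [hq, mkU_line]
  · intro X Y Z n hX hY hZ hn
    have h := (((PPS_hs n hn (Y⁻¹ * S * Z.transpose⁻¹)).C hZ).B hY).A hX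
    rw [Matrix.nonsing_inv_mul_cancel_right _ _ (by rwa [Matrix.det_transpose]),
      Matrix.mul_nonsing_inv_cancel_left _ _ hY] at h
    exact h w Q R

/-- The invariant vanishes to second order along tensors with zeroth slice `e₀ ⊗ e₀`. -/
lemma dI_IsU (U V : Ten ℂ) (hU : IsU U) : dI U V = 0 := by
  rw [dI_red II_IsU hU, hU.eq]
  exact PP_all _ _ _ _ _


/-! ### Degree bounds along rank one directions -/

lemma aeval_eps_snd (p : Polynomial ℂ) :
    (Polynomial.aeval (DualNumber.eps : DualNumber ℂ) p).snd = p.coeff 1 := by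
  induction p using Polynomial.induction_on' with
  | add p q hp hq => rw [map_add, TrivSqZeroExt.snd_add, hp, hq, Polynomial.coeff_add]
  | monomial n a =>
    rw [Polynomial.aeval_monomial, Polynomial.coeff_monomial]
    rcases n with _ | _ | n
    · simp [TrivSqZeroExt.algebraMap_eq_inl]
    · simp [TrivSqZeroExt.algebraMap_eq_inl]
    · have : (DualNumber.eps : DualNumber ℂ) ^ (n + 1 + 1) = 0 := by
        rw [pow_succ, pow_succ, mul_assoc, DualNumber.eps_mul_eps, mul_zero]
      rw [this]; simp

lemma lineP_coeff_one (U V : Ten ℂ) : (lineP U V).coeff 1 = dI U V := by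
  rw [← aeval_eps_snd, lineP_dual]; rfl

lemma lineP_coeff_zero (U V : Ten ℂ) : (lineP U V).coeff 0 = II U := by
  rw [Polynomial.coeff_zero_eq_eval_zero, lineP_eval]; simp

/-- Comparison of a polynomial and its reversal. -/
lemma rev_eq (f g : Polynomial ℂ) (d : ℕ) (h : ∀ μ : ℂ, μ ≠ 0 → g.eval μ = μ ^ d * f.eval μ⁻¹) :
    Polynomial.X ^ d * f.reverse = Polynomial.X ^ f.natDegree * g := by
  apply Polynomial.eq_of_infinite_eval_eq
  refine Set.Infinite.mono (s := {(0 : ℂ)}ᶜ) ?_ (Set.finite_singleton (0 : ℂ)).infinite_compl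
  intro μ hμ
  have hμ0 : μ ≠ 0 := hμ
  show Polynomial.eval _ _ = Polynomial.eval _ _
  let _ : Invertible (μ⁻¹) := invertibleOfNonzero (inv_ne_zero hμ0)
  have := Polynomial.eval₂_reverse_mul_pow (RingHom.id ℂ) μ⁻¹ f
  simp only [Polynomial.eval₂_id, invOf_eq_inv, inv_inv] at this
  simp only [Polynomial.eval_mul, Polynomial.eval_pow, Polynomial.eval_X, h μ hμ0]
  rw [← this, inv_pow]
  have hp : μ ^ f.natDegree ≠ 0 := pow_ne_zero _ hμ0
  field_simp

def E0 : Ten ℂ := fun i j k => if i = 0 then if j = 0 then if k = 0 then 1 else 0 else 0 else 0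

lemma deg_E0 (Y : Ten ℂ) : (lineP Y E0).natDegree ≤ 3 := by
  set U : Ten ℂ := fun i j k => if i = 0 then E0 0 j k else Y i j k with hU
  set V : Ten ℂ := fun i j k => if i = 0 then Y 0 j k else 0 with hV
  have hUU : IsU U := by
    refine ⟨?_, ?_, ?_⟩ <;> simp [hU, E0]
  have h := rev_eq (lineP Y E0) (lineP U V) 5 (by
    intro μ hμ
    rw [lineP_eval, lineP_eval]
    have e : U + μ • V = actA (Matrix.diagonal (fun i => if i = 0 then μ else 1)) (Y + μ⁻¹ • E0) := by
      funext i j k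
      simp only [actA, Matrix.diagonal_apply, ite_mul, zero_mul, Finset.sum_ite_eq,
        Finset.mem_univ, if_true]
      by_cases hi : i = 0
      · subst hi
        simp [hU, hV]
        field_simp
        ring
      · simp [hU, hV, hi, E0]
    rw [e, II_actA, Matrix.det_diagonal, Fin.prod_univ_succ]
    simp)
  have hdvd : Polynomial.X ^ 2 ∣ lineP U V := by
    rw [Polynomial.X_pow_dvd_iff]
    intro d hd
    interval_cases d
    · rw [lineP_coeff_zero, II_IsU U hUU]
    · rw [lineP_coeff_one, dI_IsU U V hUU]
  obtain ⟨q, hq⟩ := hdvd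
  by_contra hlt
  push Not at hlt
  obtain ⟨m, hm⟩ := Nat.exists_eq_add_of_le hlt
  set f := lineP Y E0 with hf
  have hf0 : f ≠ 0 := by
    intro h0
    rw [h0] at hlt
    simp at hlt
  rw [hq, hm] at h
  have h' : Polynomial.X ^ 5 * f.reverse = Polynomial.X ^ 5 * (Polynomial.X * (Polynomial.X ^ m * q)) := by
    rw [h]; ring
  have h2 := mul_left_cancel₀ (pow_ne_zero 5 Polynomial.X_ne_zero) h'
  have h3 := congrArg (fun p => Polynomial.coeff p 0) h2
  simp only [Polynomial.coeff_zero_reverse, Polynomial.coeff_X_mul_zero] at h3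
  exact hf0 (Polynomial.leadingCoeff_eq_zero.mp h3)

lemma exists_col (u : Fin 4 → ℂ) (hu : u ≠ 0) :
    ∃ g : Matrix (Fin 4) (Fin 4) ℂ, IsUnit g.det ∧ ∀ i, g i 0 = u i := by
  obtain ⟨i0, hi0⟩ := Function.ne_iff.mp hu
  refine ⟨((1 : Matrix (Fin 4) (Fin 4) ℂ).updateCol i0 u).submatrix id (Equiv.swap 0 i0), ?_, ?_⟩
  · rw [Matrix.det_permute', ← Matrix.cramer_apply, Matrix.cramer_one]
    refine IsUnit.mul ?_ (isUnit_iff_ne_zero.mpr hi0)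
    rcases Int.units_eq_one_or (Equiv.Perm.sign (Equiv.swap 0 i0)) with h | h <;> rw [h] <;> simp
  · intro i
    simp

section
variable (g h : Matrix (Fin 4) (Fin 4) ℂ) (T T' : Ten ℂ) (s : ℂ)
lemma actA_line : actA g (T + s • T') = actA g T + s • actA g T' := by
  funext i j k
  simp [actA, mul_add, Finset.sum_add_distrib, Finset.mul_sum, mul_left_comm]
lemma actB_line : actB g (T + s • T') = actB g T + s • actB g T' := by
  funext i j k
  simp [actB, mul_add, Finset.sum_add_distrib, Finset.mul_sum, mul_left_comm]
lemma actC_line : actC g (T + s • T') = actC g T + s • actC g T' := by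
  funext i j k
  simp [actC, mul_add, Finset.sum_add_distrib, Finset.mul_sum, mul_left_comm]
lemma actA_inv (hg : IsUnit g.det) : actA g (actA g⁻¹ T) = T := by
  funext i j k
  have e : ∀ f : Fin 4 → ℂ, ∑ i', g i i' * ∑ i'', g⁻¹ i' i'' * f i'' = f i := fun f => by
    have := congrFun (Matrix.mulVec_mulVec f g g⁻¹) i
    rw [Matrix.mul_nonsing_inv _ hg, Matrix.one_mulVec] at this
    exact this
  exact e (fun i => T i j k)
lemma actB_inv (hg : IsUnit g.det) : actB g (actB g⁻¹ T) = T := by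
  funext i j k
  have e : ∀ f : Fin 4 → ℂ, ∑ i', g j i' * ∑ i'', g⁻¹ i' i'' * f i'' = f j := fun f => by
    have := congrFun (Matrix.mulVec_mulVec f g g⁻¹) j
    rw [Matrix.mul_nonsing_inv _ hg, Matrix.one_mulVec] at this
    exact this
  exact e (fun j => T i j k)
lemma actC_inv (hg : IsUnit g.det) : actC g (actC g⁻¹ T) = T := by
  funext i j k
  have e : ∀ f : Fin 4 → ℂ, ∑ i', g k i' * ∑ i'', g⁻¹ i' i'' * f i'' = f k := fun f => by
    have := congrFun (Matrix.mulVec_mulVec f g g⁻¹) k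
    rw [Matrix.mul_nonsing_inv _ hg, Matrix.one_mulVec] at this
    exact this
  exact e (fun k => T i j k)
end

lemma abs_deg_rank_one (F : Ten ℂ → ℂ) (L : Ten ℂ → Ten ℂ → Polynomial ℂ)
    (hL : ∀ (U V : Ten ℂ) (s : ℂ), (L U V).eval s = F (U + s • V))
    (hA : ∀ (g : Matrix (Fin 4) (Fin 4) ℂ) (T : Ten ℂ), F (actA g T) = g.det ^ 5 * F T)
    (hB : ∀ (g : Matrix (Fin 4) (Fin 4) ℂ) (T : Ten ℂ), F (actB g T) = g.det ^ 5 * F T)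
    (hC : ∀ (g : Matrix (Fin 4) (Fin 4) ℂ) (T : Ten ℂ), F (actC g T) = g.det ^ 5 * F T)
    (hE : ∀ Y : Ten ℂ, (L Y E0).natDegree ≤ 3)
    (u v w : Fin 4 → ℂ) (Y : Ten ℂ) :
    (L Y (fun i j k => u i * v j * w k)).natDegree ≤ 3 := by
  by_cases h0 : u = 0 ∨ v = 0 ∨ w = 0
  · have e : (fun i j k => u i * v j * w k) = (0 : Ten ℂ) := by
      funext i j k
      rcases h0 with rfl | rfl | rfl <;> simp
    have e2 : L Y 0 = Polynomial.C (F Y) := by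
      apply Polynomial.funext
      intro s
      rw [hL]; simp
    rw [e, e2]; simp
  · push Not at h0
    obtain ⟨g, hg, hgu⟩ := exists_col u h0.1
    obtain ⟨h, hh, hhv⟩ := exists_col v h0.2.1
    obtain ⟨l, hl, hlw⟩ := exists_col w h0.2.2
    have e : (fun i j k => u i * v j * w k) = actA g (actB h (actC l E0)) := by
      funext i j k
      simp [actA, actB, actC, E0, hgu, hhv, hlw, mul_assoc]
    set Y' := actC l⁻¹ (actB h⁻¹ (actA g⁻¹ Y)) with hY'
    have eY : Y = actA g (actB h (actC l Y')) := by
      rw [hY', actC_inv _ _ hl, actB_inv _ _ hh, actA_inv _ _ hg]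
    have e3 : L Y (fun i j k => u i * v j * w k) =
        Polynomial.C (g.det ^ 5 * (h.det ^ 5 * l.det ^ 5)) * L Y' E0 := by
      apply Polynomial.funext
      intro s
      rw [Polynomial.eval_mul, Polynomial.eval_C, hL, hL, e, eY, ← actA_line,
        ← actB_line, ← actC_line, hA, hB, hC]
      ring
    rw [e3]
    exact (Polynomial.natDegree_C_mul_le _ _).trans (hE Y')

lemma deg_rank_one (u v w : Fin 4 → ℂ) (Y : Ten ℂ) :
    (lineP Y (fun i j k => u i * v j * w k)).natDegree ≤ 3 :=
  abs_deg_rank_one II lineP lineP_eval II_actA II_actB II_actC deg_E0 u v w Y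


/-! ### Degree bounds along tensors of rank at most six, and the conclusion -/

section
variable (F : Ten ℂ → ℂ) (L : Ten ℂ → Ten ℂ → Polynomial ℂ)

lemma abs_add_deg (hL : ∀ (U V : Ten ℂ) (s : ℂ), (L U V).eval s = F (U + s • V))
    (a b : Ten ℂ) (m n : ℕ) (ha : ∀ Y, (L Y a).natDegree ≤ m)
    (hb : ∀ Y, (L Y b).natDegree ≤ n) (Y : Ten ℂ) :
    (L Y (a + b)).natDegree ≤ m + n := by
  have hinj : Set.InjOn (fun j : ℕ => (j : ℂ)) (Finset.range (m + 1) : Finset ℕ) :=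
    fun x _ y _ h => Nat.cast_injective h
  have e : L Y (a + b) = ∑ j ∈ Finset.range (m + 1),
      Lagrange.basis (Finset.range (m + 1)) (fun j : ℕ => (j : ℂ)) j *
        L (Y + (j : ℂ) • a) b := by
    apply Polynomial.funext
    intro t
    have h1 : (L Y (a + b)).eval t = (L (Y + t • b) a).eval t := by
      rw [hL, hL, smul_add]
      congr 1
      abel
    have h2 := Lagrange.eq_interpolate (f := L (Y + t • b) a) hinj (by
      rw [Finset.card_range]
      refine lt_of_le_of_lt Polynomial.degree_le_natDegree ?_
      exact_mod_cast Nat.lt_succ_of_le (ha _))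
    rw [h1, h2, Lagrange.interpolate_apply, Polynomial.eval_finsetSum, Polynomial.eval_finsetSum]
    refine Finset.sum_congr rfl fun j _ => ?_
    rw [Polynomial.eval_mul, Polynomial.eval_mul, Polynomial.eval_C, hL, hL,
      mul_comm, add_right_comm]
  rw [e]
  refine Polynomial.natDegree_sum_le_of_forall_le _ _ fun j hj => ?_
  refine Polynomial.natDegree_mul_le.trans (Nat.add_le_add ?_ (hb _))
  rw [Lagrange.natDegree_basis hinj hj, Finset.card_range, Nat.add_sub_cancel]

lemma abs_sum_deg (hL : ∀ (U V : Ten ℂ) (s : ℂ), (L U V).eval s = F (U + s • V))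
    {ι : Type} [DecidableEq ι] (s : Finset ι) (x : ι → Ten ℂ)
    (hx : ∀ i Y, (L Y (x i)).natDegree ≤ 3) (Y : Ten ℂ) :
    (L Y (∑ i ∈ s, x i)).natDegree ≤ 3 * s.card := by
  induction s using Finset.induction_on generalizing Y with
  | empty =>
    have e2 : L Y 0 = Polynomial.C (F Y) := by
      apply Polynomial.funext
      intro s
      rw [hL]; simp
    rw [Finset.sum_empty, e2]; simp
  | insert i s hi ih =>
    rw [Finset.sum_insert hi, Finset.card_insert_of_notMem hi]
    exact (abs_add_deg F L hL _ _ 3 (3 * s.card) (hx i) ih Y).trans (by omega)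

lemma abs_line_swap (hL : ∀ (U V : Ten ℂ) (s : ℂ), (L U V).eval s = F (U + s • V))
    (hF : ∀ (s : ℂ) (T : Ten ℂ), F (s • T) = s ^ 20 * F T) (T V : Ten ℂ) (μ : ℂ) (hμ : μ ≠ 0) :
    (L T V).eval μ = μ ^ 20 * (L V T).eval μ⁻¹ := by
  have e : T + μ • V = μ • (V + μ⁻¹ • T) := by
    rw [smul_add, smul_smul, mul_inv_cancel₀ hμ, one_smul, add_comm]
  rw [hL, hL, e, hF]

lemma coeff_one_of_rev (f g : Polynomial ℂ) (hf : f.natDegree ≤ 18) (d : ℕ) (hd : d = 20)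
    (h : Polynomial.X ^ d * f.reverse = Polynomial.X ^ f.natDegree * g) : g.coeff 1 = 0 := by
  obtain ⟨m, hm⟩ := Nat.exists_eq_add_of_le hf
  have hdm : d = f.natDegree + m + 2 := by omega
  have h' : Polynomial.X ^ f.natDegree * g =
      Polynomial.X ^ f.natDegree * (Polynomial.X ^ 2 * (Polynomial.X ^ m * f.reverse)) := by
    rw [← h, hdm]
    ring
  have h2 := mul_left_cancel₀ (pow_ne_zero _ Polynomial.X_ne_zero) h'
  rw [h2, Polynomial.coeff_X_pow_mul']
  simp

lemma abs_rank_six (hL : ∀ (U V : Ten ℂ) (s : ℂ), (L U V).eval s = F (U + s • V))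
    (hF : ∀ (s : ℂ) (T : Ten ℂ), F (s • T) = s ^ 20 * F T)
    (h1 : ∀ (u v w : Fin 4 → ℂ) (Y : Ten ℂ), (L Y (fun i j k => u i * v j * w k)).natDegree ≤ 3)
    (T V : Ten ℂ) (hT : rankLE T 6) : (L T V).coeff 1 = 0 := by
  obtain ⟨u, v, w, hT⟩ := hT
  have hsum : T = ∑ l : Fin 6, (fun i j k => u l i * v l j * w l k : Ten ℂ) := by
    rw [hT]
    funext i j k
    simp [Finset.sum_apply]
  have hdeg : (L V T).natDegree ≤ 18 := by
    have h := abs_sum_deg F L hL (Finset.univ : Finset (Fin 6))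
      (fun l => (fun i j k => u l i * v l j * w l k : Ten ℂ))
      (fun l Y => h1 (u l) (v l) (w l) Y) V
    rw [Finset.card_univ, Fintype.card_fin, ← hsum] at h
    exact h
  exact coeff_one_of_rev _ _ hdeg 20 rfl (rev_eq _ _ 20 (abs_line_swap F L hL hF T V))

end

lemma II_smul (s : ℂ) (T : Ten ℂ) : II (s • T) = s ^ 20 * II T := by
  have e : s • T = actA (Matrix.diagonal (fun _ => s)) T := by
    funext i j k
    simp [actA, Matrix.diagonal_apply]
  rw [e, II_actA, Matrix.det_diagonal, Finset.prod_const, Finset.card_univ, Fintype.card_fin,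
    ← pow_mul]

lemma dI_rank_six (T V : Ten ℂ) (hT : rankLE T 6) : dI T V = 0 :=
  (lineP_coeff_one T V).symm.trans
    (abs_rank_six II lineP lineP_eval II_smul deg_rank_one T V hT)

lemma final_statement : ∃ P : MvPolynomial (Fin 4 × Fin 4 × Fin 4) ℂ, P ≠ 0 ∧ P.IsHomogeneous 19 ∧
    ∀ T : Fin 4 → Fin 4 → Fin 4 → ℂ, rankLE T 6 →
      MvPolynomial.eval (fun x => T x.1 x.2.1 x.2.2) P = 0 := by
  have hex : ∃ x : Idx, MvPolynomial.pderiv x (Ipoly : MvPolynomial Idx ℂ) ≠ 0 := by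
    by_contra hno
    push Not at hno
    have := Ipoly_homog.sum_X_mul_pderiv
    simp only [hno, mul_zero, Finset.sum_const_zero] at this
    apply II_wit
    have h0 : (Ipoly : MvPolynomial Idx ℂ) = 0 := by
      simpa using this.symm
    rw [← eval_Ipoly, h0, map_zero]
  obtain ⟨x, hx⟩ := hex
  refine ⟨MvPolynomial.pderiv x Ipoly, hx, Ipoly_homog.pderiv, fun T hT => ?_⟩
  have h := dI_rank_six T (fun i j k => if (i, j, k) = x then 1 else 0) hT
  rw [dI_eq] at h
  simpa using h

/-- there is a nonzero homogeneous polynomial of degree 19 on `ℂ⁴⊗ℂ⁴⊗ℂ⁴`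
vanishing on all tensors of rank at most 6, i.e. the ideal of `σ₆(Seg(ℙ³×ℙ³×ℙ³))`
is nonzero in degree 19. -/
theorem ideal_sigma6_nonzero_in_degree_19 :
    ∃ P : MvPolynomial (Fin 4 × Fin 4 × Fin 4) ℂ, P ≠ 0 ∧ P.IsHomogeneous 19 ∧
      ∀ T : Fin 4 → Fin 4 → Fin 4 → ℂ, rankLE T 6 →
        MvPolynomial.eval (fun x => T x.1 x.2.1 x.2.2) P = 0 :=
  final_statement

end
end

section
/- For every positive integer n, the border rank of the n×n matrix multiplication tensor satisfies BR(M⟨n⟩) ≥ (3/2)·n² + n/2 − 1. -/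
open scoped BigOperators

noncomputable section

/-- Openness and perturbation: a continuous function nonvanishing at a tensor of border rank at
most `r` is nonzero at a rank-`r` decomposition whose first factors have nonzero trace. -/
lemma exists_decomp_trace_ne {n r : ℕ} (hn : 0 < n)
    (T : Fin n × Fin n → Fin n × Fin n → Fin n × Fin n → ℂ)
    (Φ : (Fin n × Fin n → Fin n × Fin n → Fin n × Fin n → ℂ) → ℂ) (hdc : Continuous Φ)
    (hT : Φ T ≠ 0) (h : T ∈ closure {S | rankLE S r}) :
    ∃ u v w : Fin r → Fin n × Fin n → ℂ, Φ (fun i j k => ∑ l, u l i * v l j * w l k) ≠ 0 ∧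
      ∀ l, ∑ i, u l (i, i) ≠ 0 := by
  obtain ⟨S, hS0, hSr⟩ := mem_closure_iff.1 h {S | Φ S ≠ 0}
    (isOpen_ne_fun hdc continuous_const) hT
  obtain ⟨u, v, w, rfl⟩ := hSr
  -- perturb the first factors so that their traces are nonzero
  let x₀ : Fin n × Fin n := (⟨0, hn⟩, ⟨0, hn⟩)
  let u' : ℂ → Fin r → Fin n × Fin n → ℂ := fun ε l x => u l x + ε * (if x = x₀ then 1 else 0)
  have hfc : Continuous fun ε : ℂ =>
      Φ (fun i j k => ∑ l, u' ε l i * v l j * w l k) := by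
    have hg : Continuous fun (ε : ℂ) (i j k : Fin n × Fin n) =>
        ∑ l, u' ε l i * v l j * w l k := by
      refine continuous_pi fun i => continuous_pi fun j => continuous_pi fun k => ?_
      simp only [u']
      fun_prop
    exact hdc.comp hg
  have hev1 : ∀ᶠ ε : ℂ in nhdsWithin 0 {0}ᶜ,
      Φ (fun i j k => ∑ l, u' ε l i * v l j * w l k) ≠ 0 := by
    refine nhdsWithin_le_nhds ((hfc.continuousAt).eventually_ne ?_)
    simpa [u'] using hS0
  have htr : ∀ ε l, ∑ i, u' ε l (i, i) = ∑ i, u l (i, i) + ε := by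
    intro ε l
    simp only [u', Finset.sum_add_distrib, ← Finset.mul_sum, x₀]
    congr 1
    rw [Finset.sum_eq_single (⟨0, hn⟩ : Fin n)]
    · simp
    · intro b _ hb
      simp [hb]
    · simp
  have hev2 : ∀ᶠ ε : ℂ in nhdsWithin 0 {0}ᶜ, ∀ l, ∑ i, u' ε l (i, i) ≠ 0 := by
    rw [Filter.eventually_all]
    intro l
    simp only [htr]
    by_cases hl : ∑ i, u l (i, i) = 0
    · filter_upwards [self_mem_nhdsWithin] with ε hε
      simpa [hl] using hε
    · refine nhdsWithin_le_nhds (ContinuousAt.eventually_ne (by fun_prop) ?_)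
      simpa using hl
  obtain ⟨ε, h1, h2⟩ := (hev1.and hev2).exists
  exact ⟨u' ε, v, w, h1, h2⟩

open Matrix in
/-- The flattening bound: a linear space of matrices `F × E`, generically factoring through `κ`,
whose matrix-multiplication flattening is left invertible. -/
lemma flattening_bound {E F κ : Type} [Fintype E] [Fintype F] [Fintype κ] [DecidableEq E]
    [DecidableEq F] {n r : ℕ} (hn : 0 < n) (G : Fin n → Fin n → Matrix F E ℂ)
    (W : Matrix (E × Fin n) (F × Fin n) ℂ)
    (hW : W * (Matrix.of fun (a : F × Fin n) (b : E × Fin n) => G a.2 b.2 a.1 b.1) = 1)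
    (hr : ∀ u : Fin n × Fin n → ℂ, ∑ i, u (i, i) ≠ 0 →
      ∃ (L : Matrix F κ ℂ) (R : Matrix κ E ℂ), ∑ x, u x • G x.1 x.2 = L * R)
    (h : matMulTensor n n n ∈ closure {S | rankLE S r}) :
    Fintype.card E * n ^ 2 ≤ Fintype.card κ * r := by
  let M : (Fin n × Fin n → Fin n × Fin n → Fin n × Fin n → ℂ) →
      Matrix ((F × Fin n) × Fin n) ((E × Fin n) × Fin n) ℂ := fun S =>
    Matrix.of fun a b => ∑ x, G x.1 x.2 a.1.1 b.1.1 * S x (b.1.2, b.2) (a.2, a.1.2)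
  let V : Matrix ((E × Fin n) × Fin n) ((F × Fin n) × Fin n) ℂ :=
    kroneckerMap (· * ·) W (1 : Matrix (Fin n) (Fin n) ℂ)
  have hMT : M (matMulTensor n n n) =
      kroneckerMap (· * ·) (Matrix.of fun (a : F × Fin n) (b : E × Fin n) => G a.2 b.2 a.1 b.1)
        (1 : Matrix (Fin n) (Fin n) ℂ) := by
    ext ⟨⟨f, i⟩, k⟩ ⟨⟨e, j⟩, k'⟩
    simp only [M, matMulTensor, kroneckerMap_apply, Matrix.of_apply, Matrix.one_apply]
    rw [Finset.sum_eq_single (i, j)]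
    · by_cases hk : k = k'
      · simp [hk]
      · simp [hk, Ne.symm hk]
    · rintro ⟨a, b⟩ - hab
      rw [if_neg, mul_zero]
      rintro ⟨h1, -, h2⟩
      exact hab (by simp_all)
    · simp
  have hVT : V * M (matMulTensor n n n) = 1 := by
    rw [hMT]
    simp only [V]
    rw [← Matrix.mul_kronecker_mul, hW, Matrix.mul_one, Matrix.one_kronecker_one]
  have hMc : Continuous M := by
    refine continuous_matrix fun a b => ?_
    simp only [M, Matrix.of_apply]
    fun_prop
  have hdc : Continuous fun S => (V * M S).det := (continuous_const.matrix_mul hMc).matrix_det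
  obtain ⟨u, v, w, h1, h2⟩ := exists_decomp_trace_ne hn _ (fun S => (V * M S).det) hdc
    (by simp [hVT]) h
  choose L R hLR using fun l => hr (u l) (h2 l)
  let LL : Matrix ((F × Fin n) × Fin n) (Fin r × κ) ℂ :=
    Matrix.of fun a s => L s.1 a.1.1 s.2 * w s.1 (a.2, a.1.2)
  let RR : Matrix (Fin r × κ) ((E × Fin n) × Fin n) ℂ :=
    Matrix.of fun s b => R s.1 s.2 b.1.1 * v s.1 (b.1.2, b.2)
  have hfac : M (fun i j k => ∑ l, u l i * v l j * w l k) = LL * RR := by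
    ext ⟨⟨f, i⟩, k⟩ ⟨⟨e, j⟩, k'⟩
    have hl : ∀ l, ∑ x, u l x * G x.1 x.2 f e = ∑ s, L l f s * R l s e := by
      intro l
      have := congrFun (congrFun (hLR l) f) e
      rw [Matrix.mul_apply, Matrix.sum_apply] at this
      exact this
    calc ∑ x, G x.1 x.2 f e * ∑ l, u l x * v l (j, k') * w l (k, i)
        = ∑ l, (∑ x, u l x * G x.1 x.2 f e) * (v l (j, k') * w l (k, i)) := by
          simp only [Finset.mul_sum, Finset.sum_mul]
          rw [Finset.sum_comm]
          refine Finset.sum_congr rfl fun l _ => Finset.sum_congr rfl fun x _ => ?_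
          ring
      _ = ∑ l, ∑ s, (L l f s * w l (k, i)) * (R l s e * v l (j, k')) := by
          refine Finset.sum_congr rfl fun l _ => ?_
          rw [hl, Finset.sum_mul]
          refine Finset.sum_congr rfl fun s _ => ?_
          ring
      _ = (LL * RR) ((f, i), k) ((e, j), k') := by
          rw [Matrix.mul_apply, Fintype.sum_prod_type]
          rfl
  rw [hfac, ← Matrix.mul_assoc] at h1
  have hrk := Matrix.rank_of_isUnit _ ((Matrix.isUnit_iff_isUnit_det _).2 (isUnit_iff_ne_zero.2 h1))
  have h3 := (Matrix.rank_mul_le_left (V * LL) RR).trans (Matrix.rank_le_card_width _)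
  rw [hrk] at h3
  simp only [Fintype.card_prod, Fintype.card_fin] at h3
  nlinarith [h3]

open Matrix in
/-- The Koszul-type bound.  `D1`, `D2` are consecutive Koszul differentials (with constant
coefficients), `X` are square matrices for which the composite is injective. -/
lemma koszul_bound {P Q R : Type} [Fintype P] [Fintype Q] [Fintype R] [DecidableEq P]
    [DecidableEq Q] [DecidableEq R] {m n r : ℕ} (hn : 0 < n)
    (D1 : Fin m → Matrix Q P ℤ) (D2 : Fin m → Matrix R Q ℤ)
    (hD : ∀ i j, D2 i * D1 j + D2 j * D1 i = 0)
    (X : Fin m → Matrix (Fin n) (Fin n) ℂ)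
    (hX : ∀ v : P → Fin n → ℂ,
      (∀ c, ∑ i, ∑ j, ∑ p, (((D2 i * D1 j) c p : ℤ) : ℂ) • ((X i * X j) *ᵥ v p) = 0) → v = 0)
    (h : matMulTensor n n n ∈ closure {S | rankLE S r}) :
    (Fintype.card P + Fintype.card Q) * n ^ 2 ≤ Fintype.card Q * r := by
  let C1 : Fin m → Matrix Q P ℂ := fun d => (D1 d).map (Int.castRingHom ℂ)
  let C2 : Fin m → Matrix R Q ℂ := fun d => (D2 d).map (Int.castRingHom ℂ)
  have hCm : ∀ i j, C2 i * C1 j = (D2 i * D1 j).map (Int.castRingHom ℂ) := fun i j =>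
    (Matrix.map_mul).symm
  have hC : ∀ i j, C2 i * C1 j + C2 j * C1 i = 0 := by
    intro i j
    rw [hCm, hCm, ← Matrix.map_add _ (map_add _), hD]
    exact Matrix.map_zero _ (map_zero _)
  let A : Matrix (Q × Fin n) (P × Fin n) ℂ := ∑ d, kroneckerMap (· * ·) (C1 d) (X d)
  let B : Matrix (R × Fin n) (Q × Fin n) ℂ := ∑ d, kroneckerMap (· * ·) (C2 d) (X d)
  have hBA : B * A = ∑ i, ∑ j, kroneckerMap (· * ·) (C2 i * C1 j) (X i * X j) := by
    simp only [A, B, Matrix.sum_mul, Matrix.mul_sum]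
    rw [Finset.sum_comm]
    refine Finset.sum_congr rfl fun i _ => Finset.sum_congr rfl fun j _ => ?_
    rw [Matrix.mul_kronecker_mul]
  have hinj : ∀ v, (B * A) *ᵥ v = 0 → v = 0 := by
    intro v hv
    have := hX (fun p t => v (p, t)) ?_
    · ext ⟨p, t⟩
      exact congrFun (congrFun this p) t
    · intro c
      ext s
      have h1 := congrFun hv (c, s)
      rw [hBA] at h1
      simp only [Matrix.sum_mulVec, Finset.sum_apply, Pi.zero_apply] at h1 ⊢
      rw [← h1]
      refine Finset.sum_congr rfl fun i _ => Finset.sum_congr rfl fun j _ => ?_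
      rw [hCm]
      simp only [Matrix.mulVec, dotProduct, Fintype.sum_prod_type, Pi.smul_apply, smul_eq_mul,
        kroneckerMap_apply, Matrix.map_apply, Finset.mul_sum, mul_assoc]
      rfl
  obtain ⟨W, hW⟩ : ∃ W : Matrix (P × Fin n) (R × Fin n) ℂ, W * (B * A) = 1 := by
    obtain ⟨g, hg⟩ := LinearMap.exists_leftInverse_of_injective (Matrix.toLin' (B * A)) (by
      rw [LinearMap.ker_eq_bot']
      intro v hv
      exact hinj v (by simpa using hv))
    refine ⟨LinearMap.toMatrix' g, ?_⟩
    have := congrArg LinearMap.toMatrix' hg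
    rwa [LinearMap.toMatrix'_comp, LinearMap.toMatrix'_toLin', LinearMap.toMatrix'_id] at this
  let G : Fin n → Fin n → Matrix (Q ⊕ R) (P ⊕ Q) ℂ := fun i j =>
    fromBlocks (-∑ d, X d i j • C1 d) ((1 : Matrix (Fin n) (Fin n) ℂ) i j • 1) 0
      (∑ d, X d i j • C2 d)
  let eE := Equiv.sumProdDistrib P Q (Fin n)
  let eF := Equiv.sumProdDistrib Q R (Fin n)
  have hG : (Matrix.of fun (a : (Q ⊕ R) × Fin n) (b : (P ⊕ Q) × Fin n) => G a.2 b.2 a.1 b.1) =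
      (fromBlocks (-A) 1 0 B).submatrix eF eE := by
    ext ⟨a | a, i⟩ ⟨b | b, j⟩
    · simp [G, eE, eF, A, Matrix.sum_apply, mul_comm]
    · by_cases h1 : a = b <;> by_cases h2 : i = j <;> simp [G, eE, eF, Matrix.one_apply, h1, h2]
    · simp [G, eE, eF]
    · simp [G, eE, eF, B, Matrix.sum_apply, mul_comm]
  let W' : Matrix ((P × Fin n) ⊕ (Q × Fin n)) ((Q × Fin n) ⊕ (R × Fin n)) ℂ :=
    fromBlocks (-(W * B)) W (1 - A * W * B) (A * W)
  have hW' : W' * fromBlocks (-A) 1 0 B = 1 := by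
    have e1 : W * B * A = 1 := by rw [Matrix.mul_assoc]; exact hW
    have e2 : A * W * B * A = A := by
      rw [Matrix.mul_assoc A, Matrix.mul_assoc A, e1, Matrix.mul_one]
    simp only [W', fromBlocks_multiply]
    rw [← fromBlocks_one]
    congr 1
    · simp [e1]
    · simp
    · simp [Matrix.sub_mul, e2]
    · simp
  have := flattening_bound (κ := Q) hn G (W'.submatrix eE eF) (by
    rw [hG, Matrix.submatrix_mul_equiv, hW', Matrix.submatrix_one_equiv]) ?_ h
  · simpa using this
  intro u hu
  let τ := ∑ i, u (i, i)
  let a : Fin m → ℂ := fun d => ∑ x, u x * X d x.1 x.2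
  let Aa := ∑ d, a d • C1 d
  let Ba := ∑ d, a d • C2 d
  have hz : Ba * Aa = 0 := by
    have e1 : Ba * Aa = ∑ i, ∑ j, (a i * a j) • (C2 i * C1 j) := by
      simp only [Aa, Ba, Matrix.sum_mul, Matrix.mul_sum]
      rw [Finset.sum_comm]
      refine Finset.sum_congr rfl fun i _ => Finset.sum_congr rfl fun j _ => ?_
      rw [Matrix.smul_mul, Matrix.mul_smul, smul_smul]
    have e2 : Ba * Aa + Ba * Aa = 0 := by
      nth_rw 2 [e1]
      rw [Finset.sum_comm, e1, ← Finset.sum_add_distrib]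
      refine Finset.sum_eq_zero fun i _ => ?_
      rw [← Finset.sum_add_distrib]
      refine Finset.sum_eq_zero fun j _ => ?_
      rw [mul_comm (a j), ← smul_add, hC, smul_zero]
    rw [← two_smul ℂ] at e2
    exact (smul_eq_zero.1 e2).resolve_left two_ne_zero
  have hsum : ∑ x, u x • G x.1 x.2 = fromBlocks (-Aa) (τ • 1) 0 Ba := by
    have hgen : ∀ {Y Z : Type} (C : Fin m → Matrix Y Z ℂ) (y : Y) (z : Z),
        ∑ x : Fin n × Fin n, u x * ∑ d, X d x.1 x.2 * C d y z = ∑ d, a d * C d y z := by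
      intro Y Z C y z
      simp only [a, Finset.mul_sum, Finset.sum_mul]
      rw [Finset.sum_comm]
      simp only [mul_assoc]
    ext (f | f) (e | e)
    · simp [Matrix.sum_apply, G, Aa, hgen]
    · simp only [Matrix.sum_apply, G, Matrix.smul_apply, fromBlocks_apply₁₂, smul_eq_mul, τ,
        Fintype.sum_prod_type, Finset.sum_mul, Matrix.one_apply (n := Fin n)]
      refine Finset.sum_congr rfl fun i _ => ?_
      rw [Finset.sum_eq_single i]
      · simp
      · intro j _ hj
        simp [Ne.symm hj]
      · simp
    · simp [Matrix.sum_apply, G]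
    · simp [Matrix.sum_apply, G, Ba, hgen]
  refine ⟨fromRows (τ • 1) Ba, fromCols (-(τ⁻¹ • Aa)) 1, ?_⟩
  rw [hsum, fromRows_mul_fromCols]
  have hτ : τ ≠ 0 := hu
  congr 1
  · simp [smul_smul, hτ]
  · simp
  · simp [hz]
  · simp

/-- First members of the six pairs in `{0,1,2,3}`. -/
def pairA : Fin 6 → Fin 4 := ![0, 0, 0, 1, 1, 2]
/-- Second members of the six pairs in `{0,1,2,3}`. -/
def pairB : Fin 6 → Fin 4 := ![1, 2, 3, 2, 3, 3]
/-- First members of the four triples. -/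
def tripA : Fin 4 → Fin 4 := ![1, 0, 0, 0]
/-- Second members of the four triples. -/
def tripB : Fin 4 → Fin 4 := ![2, 2, 1, 1]
/-- Third members of the four triples. -/
def tripC : Fin 4 → Fin 4 := ![3, 3, 3, 2]

/-- Koszul differential `Λ¹ℂ⁴ → Λ²ℂ⁴`. -/
def kos1 (i : Fin 4) : Matrix (Fin 6) (Fin 4) ℤ := Matrix.of fun q p =>
  (if i = pairA q ∧ p = pairB q then 1 else 0) - (if i = pairB q ∧ p = pairA q then 1 else 0)

/-- Koszul differential `Λ²ℂ⁴ → Λ³ℂ⁴`. -/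
def kos2 (i : Fin 4) : Matrix (Fin 4) (Fin 6) ℤ := Matrix.of fun c q =>
  (if i = tripA c ∧ pairA q = tripB c ∧ pairB q = tripC c then 1 else 0)
  - (if i = tripB c ∧ pairA q = tripA c ∧ pairB q = tripC c then 1 else 0)
  + (if i = tripC c ∧ pairA q = tripA c ∧ pairB q = tripB c then 1 else 0)

lemma kos_anti : ∀ i j, kos2 i * kos1 j + kos2 j * kos1 i = 0 := by decide +kernel

/-- The Levi-Civita table: the composite of the two differentials. -/
def lev (i j c p : Fin 4) : ℤ :=
  (if i = tripA c ∧ j = tripB c ∧ p = tripC c then 1 else 0)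
  - (if i = tripA c ∧ j = tripC c ∧ p = tripB c then 1 else 0)
  - (if i = tripB c ∧ j = tripA c ∧ p = tripC c then 1 else 0)
  + (if i = tripB c ∧ j = tripC c ∧ p = tripA c then 1 else 0)
  + (if i = tripC c ∧ j = tripA c ∧ p = tripB c then 1 else 0)
  - (if i = tripC c ∧ j = tripB c ∧ p = tripA c then 1 else 0)

lemma kos_comp : ∀ i j c p, (kos2 i * kos1 j) c p = lev i j c p := by decide +kernel

lemma kos_sum {V : Type*} [AddCommGroup V] [Module ℂ V] (f : Fin 4 → Fin 4 → Fin 4 → V)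
    (c : Fin 4) :
    ∑ i, ∑ j, ∑ p, (((kos2 i * kos1 j) c p : ℤ) : ℂ) • f i j p =
      f (tripA c) (tripB c) (tripC c) - f (tripA c) (tripC c) (tripB c)
      - f (tripB c) (tripA c) (tripC c) + f (tripB c) (tripC c) (tripA c)
      + f (tripC c) (tripA c) (tripB c) - f (tripC c) (tripB c) (tripA c) := by
  have key : ∀ (a b d : Fin 4), ∑ i, ∑ j, ∑ p,
      (((if i = a ∧ j = b ∧ p = d then 1 else 0 : ℤ)) : ℂ) • f i j p = f a b d := by
    intro a b d
    rw [Finset.sum_eq_single a, Finset.sum_eq_single b, Finset.sum_eq_single d]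
    · simp
    · intro x _ hx; simp [hx]
    · simp
    · intro x _ hx; simp [hx]
    · simp
    · intro x _ hx; simp [hx]
    · simp
  simp only [kos_comp, lev, Int.cast_sub, Int.cast_add, sub_smul, add_smul,
    Finset.sum_sub_distrib, Finset.sum_add_distrib, key]

open Matrix in
/-- Existence of four matrices with injective Koszul composite. -/
def KosGood (ι : Type) [Fintype ι] : Prop :=
  ∃ X : Fin 4 → Matrix ι ι ℂ, ∀ v : Fin 4 → ι → ℂ,
    (∀ c, (X (tripA c) * X (tripB c)) *ᵥ v (tripC c) - (X (tripA c) * X (tripC c)) *ᵥ v (tripB c)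
      - (X (tripB c) * X (tripA c)) *ᵥ v (tripC c) + (X (tripB c) * X (tripC c)) *ᵥ v (tripA c)
      + (X (tripC c) * X (tripA c)) *ᵥ v (tripB c) - (X (tripC c) * X (tripB c)) *ᵥ v (tripA c)
      = 0) → v = 0

open Matrix in
lemma KosGood.sum {ι κ : Type} [Fintype ι] [Fintype κ] (h1 : KosGood ι) (h2 : KosGood κ) :
    KosGood (ι ⊕ κ) := by
  obtain ⟨X, hX⟩ := h1
  obtain ⟨Y, hY⟩ := h2
  refine ⟨fun d => fromBlocks (X d) 0 0 (Y d), fun v hv => ?_⟩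
  have e1 := hX (fun d => v d ∘ Sum.inl) fun c => by
    ext i
    have := congrFun (hv c) (Sum.inl i)
    simpa [fromBlocks_multiply, fromBlocks_mulVec] using this
  have e2 := hY (fun d => v d ∘ Sum.inr) fun c => by
    ext i
    have := congrFun (hv c) (Sum.inr i)
    simpa [fromBlocks_multiply, fromBlocks_mulVec] using this
  ext d (i | i)
  · exact congrFun (congrFun e1 d) i
  · exact congrFun (congrFun e2 d) i

open Matrix in
lemma KosGood.equiv {ι κ : Type} [Fintype ι] [Fintype κ] (e : κ ≃ ι) (h : KosGood ι) :
    KosGood κ := by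
  obtain ⟨X, hX⟩ := h
  refine ⟨fun d => (X d).submatrix e e, fun v hv => ?_⟩
  have e1 := hX (fun d => v d ∘ e.symm) fun c => by
    ext i
    have := congrFun (hv c) (e.symm i)
    simpa [Matrix.submatrix_mul_equiv, Matrix.submatrix_mulVec_equiv] using this
  ext d i
  simpa using congrFun (congrFun e1 d) (e i)

lemma kosGood3 : KosGood (Fin 3) := by
  refine ⟨![!![0,1,0;0,0,1;0,0,0], !![0,0,1;0,0,0;0,0,0], !![0,0,0;1,0,0;0,1,0],
    !![0,0,0;0,0,0;1,0,0]], fun v hv => ?_⟩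
  simp [Fin.forall_fin_succ, funext_iff, tripA, tripB, tripC, Matrix.mulVec, dotProduct,
    Matrix.mul_apply, Fin.sum_univ_succ] at hv ⊢
  grind

lemma kosGood4 : KosGood (Fin 4) := by
  refine ⟨![!![1,0,1,0;1,1,0,0;0,0,1,0;0,0,0,1], !![0,0,0,0;0,0,0,0;0,0,0,1;0,1,0,0],
    !![0,1,0,0;0,0,0,0;1,0,0,0;0,0,0,0], !![0,0,0,0;0,0,0,1;0,0,0,0;0,0,1,0]], fun v hv => ?_⟩
  simp [Fin.forall_fin_succ, funext_iff, tripA, tripB, tripC, Matrix.mulVec, dotProduct,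
    Matrix.mul_apply, Fin.sum_univ_succ] at hv ⊢
  grind

lemma kosGood5 : KosGood (Fin 5) := by
  refine ⟨![!![0,0,0,1,0;0,0,0,0,1;1,0,0,0,0;0,1,0,0,0;0,0,0,0,0],
    !![0,0,0,0,1;1,0,0,0,0;0,1,0,0,0;0,0,1,0,0;0,0,0,1,0],
    !![0,0,0,1,0;0,0,0,0,0;0,0,0,0,0;0,1,0,0,0;0,0,1,0,0],
    !![0,0,0,0,1;0,0,0,0,0;0,1,0,0,0;0,0,0,0,0;0,0,0,0,0]], fun v hv => ?_⟩
  simp [Fin.forall_fin_succ, funext_iff, tripA, tripB, tripC, Matrix.mulVec, dotProduct,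
    Matrix.mul_apply, Fin.sum_univ_succ] at hv ⊢
  grind

lemma kosGood_fin : ∀ n : ℕ, 3 ≤ n → KosGood (Fin n)
  | 0, h | 1, h | 2, h => by omega
  | 3, _ => kosGood3
  | 4, _ => kosGood4
  | 5, _ => kosGood5
  | n + 6, _ => ((kosGood_fin (n + 3) (by omega)).sum kosGood3).equiv
      (finSumFinEquiv (m := n + 3) (n := 3)).symm

lemma bound_one {r : ℕ} (h : matMulTensor 1 1 1 ∈ closure {S | rankLE S r}) : 1 ≤ r := by
  have := koszul_bound (P := Fin 0) (Q := Fin 1) (R := Fin 0) (m := 0) one_pos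
    (fun _ => 0) (fun _ => 0) (by simp) (fun _ => 0) (fun v _ => Subsingleton.elim _ _) h
  simpa using this

lemma bound_two {r : ℕ} (h : matMulTensor 2 2 2 ∈ closure {S | rankLE S r}) : 6 ≤ r := by
  have := koszul_bound (P := Fin 1) (Q := Fin 2) (R := Fin 1) (m := 2) two_pos
    ![!![1; 0], !![0; 1]] ![!![0, 1], !![-1, 0]] (by decide +kernel)
    ![!![0, 1; 0, 0], !![0, 0; 1, 0]] (fun v hv => by
      simp [Fin.forall_fin_succ, funext_iff, Matrix.mulVec, dotProduct,
        Matrix.mul_apply, Fin.sum_univ_succ] at hv ⊢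
      exact hv) h
  simp at this
  omega

lemma bound_ge_three {n r : ℕ} (hn : 3 ≤ n)
    (h : matMulTensor n n n ∈ closure {S | rankLE S r}) : 10 * n ^ 2 ≤ 6 * r := by
  obtain ⟨X, hX⟩ := kosGood_fin n hn
  have := koszul_bound (by omega) kos1 kos2 kos_anti X (fun v hv => hX v fun c => by
    rw [← kos_sum (fun i j p => (X i * X j).mulVec (v p)) c]
    exact hv c) h
  simpa using this

lemma matMul_rankLE (n : ℕ) : ∃ r, rankLE (matMulTensor n n n) r := by
  let e := Fintype.equivFin (Fin n × Fin n × Fin n)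
  refine ⟨Fintype.card (Fin n × Fin n × Fin n),
    fun l x => if x = ((e.symm l).1, (e.symm l).2.1) then 1 else 0,
    fun l x => if x = ((e.symm l).2.1, (e.symm l).2.2) then 1 else 0,
    fun l x => if x = ((e.symm l).2.2, (e.symm l).1) then 1 else 0, ?_⟩
  ext ⟨i, j⟩ ⟨j', k⟩ ⟨k', i'⟩
  rw [e.symm.sum_comp (fun t : Fin n × Fin n × Fin n =>
    (if (i, j) = (t.1, t.2.1) then (1 : ℂ) else 0) * (if (j', k) = (t.2.1, t.2.2) then 1 else 0) *
      (if (k', i') = (t.2.2, t.1) then 1 else 0))]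
  rw [Finset.sum_eq_single (i, j, k)]
  · simp only [matMulTensor, Prod.mk.injEq]
    grind
  · rintro ⟨a, b, c⟩ - hne
    simp only [Prod.mk.injEq]
    grind
  · simp

/-- `BR(M⟨n⟩) ≥ (3/2)·n² + n/2 − 1`. -/
theorem borderRank_matMul_ge_lickteig (n : ℕ) (hn : 1 ≤ n) :
    (3 / 2 : ℝ) * (n : ℝ) ^ 2 + (n : ℝ) / 2 - 1 ≤ (brank (matMulTensor n n n) : ℝ) := by
  have hmem : matMulTensor n n n ∈
      closure {S | rankLE S (brank (matMulTensor n n n))} := by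
    have hne : {r | matMulTensor n n n ∈ closure {S | rankLE S r}}.Nonempty := by
      obtain ⟨r, hr⟩ := matMul_rankLE n
      exact ⟨r, subset_closure hr⟩
    exact Nat.sInf_mem hne
  generalize brank (matMulTensor n n n) = r at hmem ⊢
  obtain rfl | rfl | h3 : n = 1 ∨ n = 2 ∨ 3 ≤ n := by omega
  · have : (1 : ℝ) ≤ r := by exact_mod_cast bound_one hmem
    push_cast
    linarith
  · have : (6 : ℝ) ≤ r := by exact_mod_cast bound_two hmem
    push_cast
    linarith
  · have : (10 : ℝ) * (n : ℝ) ^ 2 ≤ 6 * r := by exact_mod_cast bound_ge_three h3 hmem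
    have h3' : (3 : ℝ) ≤ n := by exact_mod_cast h3
    nlinarith [sq_nonneg ((n : ℝ) - 3)]

end
end
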